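/- Let f(z) = ∑_{k≥1} a_{2k−1} z^{2k−1} be odd and univalent (injective) in the unit disk 𝔻 with a_1 = 1, and let g(z) = ∑_{k≥1} b_{2k−1} z^{2k−1} be an odd analytic function in 𝔻 subordinate to f. Then for every 0 ≤ r < 1 one has ∑_{k≥1} |b_{2k−1}| r^{2k−1} ≤ r/(1 − r²); in particular ∑_{k≥1} |b_{2k−1}| r^{2k−1} ≤ 1 for all r ≤ (√5 − 1)/2, and this Bohr radius is sharp, with equality attained by f(z) = g(z) = z/(1 − z²) at r = (√5 − 1)/2. -/

import Mathlib

namespace Bohr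
open Complex Metric Set Filter Topology
open scoped ComplexConjugate

theorem hs_congr {f g : ℕ → ℂ} {a : ℂ} (h : HasSum f a) (e : ∀ k, g k = f k) : HasSum g a := by
  rw [funext e]; exact h

/-- power series representation on the disc of radius `r` -/
def PS (c : ℕ → ℂ) (r : ℝ) (f : ℂ → ℂ) : Prop :=
  ∀ z : ℂ, ‖z‖ < r → HasSum (fun k : ℕ => c k * z ^ k) (f z)

/-- circle average -/
noncomputable def M {E : Type*} [NormedAddCommGroup E] [NormedSpace ℝ E] (s : ℝ) (f : ℂ → E) : E :=
  Real.circleAverage f 0 s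

theorem exists_PS {f : ℂ → ℂ} {r : ℝ} (hf : DifferentiableOn ℂ f (ball 0 r)) :
    ∃ c, PS c r f := by
  refine ⟨fun n => (n.factorial : ℂ)⁻¹ * iteratedDeriv n f 0, fun z hz => ?_⟩
  have := Complex.hasSum_taylorSeries_on_ball (c := 0) (r := r) hf (z := z) (by simpa using hz)
  refine hs_congr this fun n => ?_
  simp [smul_eq_mul]; ring

theorem PS.summable {c : ℕ → ℂ} {r : ℝ} {f : ℂ → ℂ} (h : PS c r f) {x : ℝ} (hx0 : 0 ≤ x)
    (hx : x < r) : Summable (fun k : ℕ => ‖c k‖ * x ^ k) := by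
  have h1 := (h (x : ℂ) (by simpa [abs_of_nonneg hx0] using hx)).summable.norm
  refine h1.congr fun k => ?_
  simp [abs_of_nonneg hx0]

theorem PS.mono {c : ℕ → ℂ} {r r' : ℝ} {f : ℂ → ℂ} (h : PS c r f) (hr : r' ≤ r) : PS c r' f :=
  fun z hz => h z (hz.trans_le hr)

theorem PS.congr {c : ℕ → ℂ} {r : ℝ} {f g : ℂ → ℂ} (h : PS c r f)
    (hfg : ∀ z, ‖z‖ < r → f z = g z) : PS c r g :=
  fun z hz => by rw [← hfg z hz]; exact h z hz

theorem PS.zero_val {c : ℕ → ℂ} {r : ℝ} {f : ℂ → ℂ} (h : PS c r f) (hr : 0 < r) : f 0 = c 0 := by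
  have h1 := h 0 (by simpa using hr)
  have h2 := hasSum_single (f := fun k : ℕ => c k * (0:ℂ) ^ k) 0 (fun k hk => by simp [hk])
  simpa using h1.unique h2

theorem PS.add {c d : ℕ → ℂ} {r : ℝ} {f g : ℂ → ℂ} (h : PS c r f) (h' : PS d r g) :
    PS (fun k => c k + d k) r (fun z => f z + g z) := fun z hz => by
  simpa [add_mul] using (h z hz).add (h' z hz)

theorem PS.sub {c d : ℕ → ℂ} {r : ℝ} {f g : ℂ → ℂ} (h : PS c r f) (h' : PS d r g) :
    PS (fun k => c k - d k) r (fun z => f z - g z) := fun z hz => by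
  simpa [sub_mul] using (h z hz).sub (h' z hz)

theorem PS.cmul {c : ℕ → ℂ} {r : ℝ} {f : ℂ → ℂ} (h : PS c r f) (a : ℂ) :
    PS (fun k => a * c k) r (fun z => a * f z) := fun z hz => by
  simpa [mul_assoc] using (h z hz).mul_left a

theorem PS_const (a : ℂ) (r : ℝ) : PS (fun k => if k = 0 then a else 0) r (fun _ => a) := fun z _ => by
  have h2 := hasSum_single (f := fun k : ℕ => (if k = 0 then a else 0) * z ^ k) 0
    (fun k hk => by simp [hk])
  simpa using h2

theorem PS.both {c : ℕ → ℂ} {r : ℝ} {f : ℂ → ℂ} (h : PS c r f) :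
    DifferentiableOn ℂ f (ball 0 r) ∧
    ∀ z, ‖z‖ < r → HasSum (fun k : ℕ => c k * (k * z ^ (k - 1))) (deriv f z) := by
  have key : ∀ z, ‖z‖ < r → DifferentiableAt ℂ f z ∧
      HasSum (fun k : ℕ => c k * (k * z ^ (k - 1))) (deriv f z) := by
    intro z hz
    obtain ⟨x, hzx, hxr⟩ := exists_between hz
    have hx0 : 0 ≤ x := (norm_nonneg z).trans hzx.le
    have hs := h.summable hx0 hxr
    have hd : ∀ k : ℕ, DifferentiableOn ℂ (fun w : ℂ => c k * w ^ k) (ball 0 x) := fun k =>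
      (by fun_prop)
    have hb : ∀ (k : ℕ) (w : ℂ), w ∈ ball (0:ℂ) x → ‖c k * w ^ k‖ ≤ ‖c k‖ * x ^ k := by
      intro k w hw
      have : ‖w‖ < x := by simpa using hw
      rw [norm_mul, norm_pow]; gcongr
    have e : (fun w => ∑' k, c k * w ^ k) =ᶠ[𝓝 z] f := by
      filter_upwards [isOpen_ball.mem_nhds (show z ∈ ball (0:ℂ) x by simpa using hzx)] with w hw
      exact (h w (lt_trans (by simpa using hw) hxr)).tsum_eq
    have h1 := Complex.differentiableOn_tsum_of_summable_norm hs hd isOpen_ball hb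
    have h2 := Complex.hasSum_deriv_of_summable_norm hs hd isOpen_ball hb
      (show z ∈ ball (0:ℂ) x by simpa using hzx)
    rw [e.deriv_eq] at h2
    refine ⟨((h1.differentiableAt (isOpen_ball.mem_nhds (by simpa using hzx))).congr_of_eventuallyEq e.symm), ?_⟩
    refine hs_congr h2 fun k => ?_
    rw [deriv_const_mul _ (by fun_prop)]; simp
  exact ⟨fun z hz => (key z (by simpa using hz)).1.differentiableWithinAt, fun z hz => (key z hz).2⟩

theorem PS.diff {c : ℕ → ℂ} {r : ℝ} {f : ℂ → ℂ} (h : PS c r f) :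
    DifferentiableOn ℂ f (ball 0 r) := h.both.1

theorem PS.zderiv {c : ℕ → ℂ} {r : ℝ} {f : ℂ → ℂ} (h : PS c r f) :
    PS (fun k => k * c k) r (fun z => z * deriv f z) := fun z hz => by
  refine hs_congr ((h.both.2 z hz).mul_left z) fun k => ?_
  rcases k with _ | k
  · simp
  · simp [pow_succ]; ring

theorem PS.mul {c d : ℕ → ℂ} {r : ℝ} {f g : ℂ → ℂ} (h : PS c r f) (h' : PS d r g) :
    PS (fun n => ∑ p ∈ Finset.HasAntidiagonal.antidiagonal n, c p.1 * d p.2) r (fun z => f z * g z) := fun z hz => by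
  have h1 := (h z hz).summable.norm
  have h2 := (h' z hz).summable.norm
  have h3 := (summable_norm_sum_mul_antidiagonal_of_summable_norm h1 h2).of_norm.hasSum
  rw [← tsum_mul_tsum_eq_tsum_sum_antidiagonal_of_summable_norm h1 h2, (h z hz).tsum_eq,
    (h' z hz).tsum_eq] at h3
  refine hs_congr h3 fun n => ?_
  rw [Finset.sum_mul]
  refine Finset.sum_congr rfl fun p hp => ?_
  rw [Finset.HasAntidiagonal.mem_antidiagonal] at hp
  rw [← hp, pow_add]; ring

/-! circle averages -/

theorem circInt {E : Type*} [NormedAddCommGroup E] {s : ℝ} {f : ℂ → E} (hs : 0 ≤ s)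
    (hf : ContinuousOn f (sphere 0 s)) : CircleIntegrable f 0 s :=
  ContinuousOn.circleIntegrable hs hf

theorem M_hasSum {s : ℝ} (hs : 0 ≤ s) {F : ℕ → ℂ → ℂ} {G : ℂ → ℂ} {B : ℕ → ℝ} (hB : Summable B)
    (hF : ∀ k, ContinuousOn (F k) (sphere 0 s)) (hFB : ∀ k z, ‖z‖ = s → ‖F k z‖ ≤ B k)
    (hG : ∀ z, ‖z‖ = s → HasSum (fun k => F k z) (G z)) :
    HasSum (fun k => M s (F k)) (M s G) := by
  have hn : ∀ θ : ℝ, ‖circleMap 0 s θ‖ = s := fun θ => by simp [abs_of_nonneg hs]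
  have := intervalIntegral.hasSum_integral_of_dominated_convergence (ι := ℕ)
    (μ := MeasureTheory.volume) (a := 0) (b := 2 * Real.pi)
    (F := fun k θ => F k (circleMap 0 s θ)) (f := fun θ => G (circleMap 0 s θ))
    (fun k _ => B k) (fun k => ?_) (fun k => ?_) ?_ ?_ ?_
  · unfold M Real.circleAverage
    exact this.const_smul _
  · refine Continuous.aestronglyMeasurable ?_
    exact (hF k).comp_continuous (continuous_circleMap 0 s) (fun θ => by simp [abs_of_nonneg hs])
  · exact Eventually.of_forall fun θ _ => hFB k _ (hn θ)
  · exact Eventually.of_forall fun θ _ => hB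
  · exact intervalIntegrable_const
  · exact Eventually.of_forall fun θ _ => hG _ (hn θ)

theorem M_congr {E : Type*} [NormedAddCommGroup E] [NormedSpace ℝ E] {s : ℝ} (hs : 0 ≤ s) {f g : ℂ → E}
    (h : ∀ z, ‖z‖ = s → f z = g z) : M s f = M s g :=
  Real.circleAverage_congr_sphere fun z hz => h z (by simpa [abs_of_nonneg hs] using hz)

theorem M_const_mul {s : ℝ} (a : ℂ) (f : ℂ → ℂ) : M s (fun z => a * f z) = a * M s f := by
  unfold M; exact Real.circleAverage_fun_smul (a := a) (f := f)

theorem M_conj {s : ℝ} (f : ℂ → ℂ) : M s (fun z => conj (f z)) = conj (M s f) := by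
  unfold M Real.circleAverage
  simp only [Complex.real_smul, map_mul, Complex.conj_ofReal]
  congr 1
  rw [intervalIntegral.integral_of_le (by positivity), intervalIntegral.integral_of_le (by positivity)]
  exact integral_conj

theorem M_analytic {s : ℝ} (hs : 0 ≤ s) {r : ℝ} (hsr : s < r) {f : ℂ → ℂ}
    (hf : DifferentiableOn ℂ f (ball 0 r)) : M s f = f 0 := by
  unfold M
  apply DiffContOnCl.circleAverage
  rw [abs_of_nonneg hs]
  exact (hf.mono (closure_ball_subset_closedBall.trans (closedBall_subset_ball hsr))).diffContOnCl

theorem M_pow_pos {s : ℝ} (hs : 0 ≤ s) {k : ℕ} (hk : k ≠ 0) : M s (fun z : ℂ => z ^ k) = 0 := by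
  rw [M_analytic hs (lt_add_one s) (by fun_prop)]; simp [hk]

theorem M_const {s : ℝ} (a : ℂ) : M s (fun _ : ℂ => a) = a := Real.circleAverage_const a 0 s

theorem M_constR {s : ℝ} (a : ℝ) : M s (fun _ : ℂ => a) = a := Real.circleAverage_const a 0 s

theorem M_conj_pow {s : ℝ} (hs : 0 ≤ s) (j k : ℕ) :
    M s (fun z : ℂ => conj (z ^ j) * z ^ k) = if k = j then ((s ^ (2 * j) : ℝ) : ℂ) else 0 := by
  have hz : ∀ z : ℂ, ‖z‖ = s → conj z * z = ((s ^ 2 : ℝ) : ℂ) := fun z hz => by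
    rw [mul_comm, Complex.mul_conj, Complex.normSq_eq_norm_sq, hz]
  rcases lt_trichotomy k j with h | h | h
  · obtain ⟨l, rfl⟩ := Nat.exists_eq_add_of_lt h
    rw [if_neg (by omega), M_congr (g := fun z => ((s ^ 2 : ℝ) : ℂ) ^ k * conj (z ^ (l + 1))) hs,
      M_const_mul, M_conj, M_pow_pos hs (by omega)]
    · simp
    · intro z h'; rw [← hz z h', map_pow, map_pow]; ring
  · subst h
    rw [if_pos rfl, M_congr (g := fun z => ((s ^ 2 : ℝ) : ℂ) ^ k) hs, M_const]
    · push_cast; ring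
    · intro z h'; rw [← hz z h', map_pow]; ring
  · obtain ⟨l, rfl⟩ := Nat.exists_eq_add_of_lt h
    rw [if_neg (by omega), M_congr (g := fun z => ((s ^ 2 : ℝ) : ℂ) ^ j * (z ^ (l + 1))) hs,
      M_const_mul, M_pow_pos hs (by omega)]
    · simp
    · intro z h'; rw [← hz z h', map_pow]; ring

theorem PS.contOn {c : ℕ → ℂ} {r : ℝ} {f : ℂ → ℂ} (h : PS c r f) {s : ℝ} (hsr : s < r) :
    ContinuousOn f (sphere 0 s) :=
  h.diff.continuousOn.mono (sphere_subset_closedBall.trans (closedBall_subset_ball hsr))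

theorem cpt_bound {f : ℂ → ℂ} {s : ℝ} (h : ContinuousOn f (sphere 0 s)) :
    ∃ C : ℝ, 0 ≤ C ∧ ∀ z : ℂ, ‖z‖ = s → ‖f z‖ ≤ C := by
  obtain ⟨C, hC⟩ := (isCompact_sphere (0:ℂ) s).exists_bound_of_continuousOn h
  exact ⟨max C 0, le_max_right _ _, fun z hz => (hC z (by simpa using hz)).trans (le_max_left _ _)⟩

theorem PS.fourier {c : ℕ → ℂ} {r : ℝ} {f : ℂ → ℂ} (h : PS c r f) {s : ℝ} (hs : 0 ≤ s) (hsr : s < r)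
    (j : ℕ) : M s (fun z => conj (z ^ j) * f z) = c j * ((s ^ (2 * j) : ℝ) : ℂ) := by
  have h1 := M_hasSum hs (F := fun k z => conj (z ^ j) * (c k * z ^ k))
    (G := fun z => conj (z ^ j) * f z) (B := fun k => s ^ j * (‖c k‖ * s ^ k))
    ((h.summable hs hsr).mul_left _) (fun k => by
      apply Continuous.continuousOn; fun_prop)
    (fun k z hz => by rw [norm_mul, norm_mul, RCLike.norm_conj, norm_pow, norm_pow, hz])
    (fun z hz => (h z (by linarith)).mul_left _)
  have h2 : (fun k => M s (fun z => conj (z ^ j) * (c k * z ^ k)))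
      = fun k => if k = j then c j * ((s ^ (2 * j) : ℝ) : ℂ) else 0 := by
    funext k
    rw [M_congr (g := fun z => c k * (conj (z ^ j) * z ^ k)) hs (fun z _ => by ring), M_const_mul,
      M_conj_pow hs]
    split_ifs with h
    · rw [h]
    · simp
  rw [h2] at h1
  exact h1.unique (hasSum_ite_eq j _)

theorem PS.unique {c d : ℕ → ℂ} {r : ℝ} {f : ℂ → ℂ} (h : PS c r f) (h' : PS d r f) (hr : 0 < r) :
    c = d := by
  funext j
  have h1 := h.fourier (s := r / 2) (by positivity) (by linarith) j
  rw [h'.fourier (s := r / 2) (by positivity) (by linarith) j] at h1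
  have : (((r / 2) ^ (2 * j) : ℝ) : ℂ) ≠ 0 := by
    have : (r / 2) ^ (2 * j) ≠ 0 := by positivity
    exact_mod_cast this
  exact (mul_right_cancel₀ this h1).symm

theorem PS.parseval {c d : ℕ → ℂ} {r : ℝ} {f g : ℂ → ℂ} (h : PS c r f) (h' : PS d r g)
    {s : ℝ} (hs : 0 ≤ s) (hsr : s < r) :
    HasSum (fun k => conj (c k) * d k * ((s ^ (2 * k) : ℝ) : ℂ)) (M s (fun z => conj (f z) * g z)) := by
  obtain ⟨C, hC0, hC⟩ := cpt_bound (h'.contOn hsr)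
  have h1 := M_hasSum hs (F := fun k z => conj (c k * z ^ k) * g z)
    (G := fun z => conj (f z) * g z) (B := fun k => (‖c k‖ * s ^ k) * C)
    ((h.summable hs hsr).mul_right _) (fun k => by
      refine ContinuousOn.mul (Continuous.continuousOn (by fun_prop)) (h'.contOn hsr))
    (fun k z hz => by
      rw [norm_mul, RCLike.norm_conj, norm_mul, norm_pow, hz]
      exact mul_le_mul_of_nonneg_left (hC z hz) (by positivity))
    (fun z hz => by
      have := (h z (by linarith)).map (starRingEnd ℂ) Complex.continuous_conj
      exact this.mul_right _)
  convert h1 using 2 with k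
  rw [mul_assoc, ← h'.fourier hs hsr k, ← M_const_mul]
  refine M_congr hs fun z _ => ?_
  simp only [map_mul]; ring

theorem PS.parseval_sq {c : ℕ → ℂ} {r : ℝ} {f : ℂ → ℂ} (h : PS c r f)
    {s : ℝ} (hs : 0 ≤ s) (hsr : s < r) :
    HasSum (fun k => ‖c k‖ ^ 2 * s ^ (2 * k)) (M s (fun z => ‖f z‖ ^ 2)) := by
  have h1 := h.parseval h hs hsr
  have e : M s (fun z => conj (f z) * f z) = ((M s (fun z => ‖f z‖ ^ 2) : ℝ) : ℂ) := by
    unfold M Real.circleAverage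
    rw [Complex.real_smul, smul_eq_mul, Complex.ofReal_mul, ← intervalIntegral.integral_ofReal]
    simp only [Complex.conj_mul', Complex.ofReal_pow]
  rw [e] at h1
  rw [← Complex.hasSum_ofReal]
  convert h1 using 2 with k
  rw [Complex.conj_mul']; push_cast; rfl

theorem PS.cauchy {c : ℕ → ℂ} {r : ℝ} {f : ℂ → ℂ} (h : PS c r f) {s : ℝ} (hs : 0 ≤ s) (hsr : s < r)
    {A : ℝ} (hA : ∀ z, ‖z‖ = s → ‖f z‖ ≤ A) (k : ℕ) : ‖c k‖ * s ^ k ≤ A := by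
  have hA0 : 0 ≤ A := (norm_nonneg _).trans (hA (s : ℂ) (by simp [abs_of_nonneg hs]))
  have h1 := h.parseval_sq hs hsr
  have h2 := le_hasSum h1 k (fun j _ => by positivity)
  have h3 : M s (fun z => ‖f z‖ ^ 2) ≤ A ^ 2 := by
    refine Real.circleAverage_mono_on_of_le_circle (circInt hs ?_) ?_
    · exact (h.contOn hsr).norm.pow 2
    · intro z hz
      have := hA z (by simpa [abs_of_nonneg hs] using hz)
      gcongr
  refine le_of_sq_le_sq ?_ hA0
  calc _ = ‖c k‖ ^ 2 * s ^ (2 * k) := by ring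
    _ ≤ _ := h2.trans h3

end Bohr


namespace Bohr
open Complex Metric Set Filter Topology
open scoped ComplexConjugate

theorem M_mono {s : ℝ} (hs : 0 ≤ s) {f g : ℂ → ℝ} (hf : ContinuousOn f (sphere 0 s))
    (hg : ContinuousOn g (sphere 0 s)) (h : ∀ z, ‖z‖ = s → f z ≤ g z) : M s f ≤ M s g :=
  Real.circleAverage_mono (circInt hs hf) (circInt hs hg)
    fun z hz => h z (by simpa [abs_of_nonneg hs] using hz)

theorem M_add {E : Type*} [NormedAddCommGroup E] [NormedSpace ℝ E] {s : ℝ} (hs : 0 ≤ s) {f g : ℂ → E}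
    (hf : ContinuousOn f (sphere 0 s))
    (hg : ContinuousOn g (sphere 0 s)) : M s (fun z => f z + g z) = M s f + M s g :=
  Real.circleAverage_fun_add (circInt hs hf) (circInt hs hg)

theorem M_sub {E : Type*} [NormedAddCommGroup E] [NormedSpace ℝ E] {s : ℝ} (hs : 0 ≤ s) {f g : ℂ → E}
    (hf : ContinuousOn f (sphere 0 s))
    (hg : ContinuousOn g (sphere 0 s)) : M s (fun z => f z - g z) = M s f - M s g :=
  Real.circleAverage_fun_sub (circInt hs hf) (circInt hs hg)

theorem M_const_mulR {s : ℝ} (a : ℝ) (f : ℂ → ℝ) : M s (fun z => a * f z) = a * M s f := by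
  unfold M; exact Real.circleAverage_fun_smul (a := a) (f := f)

theorem M_re {s : ℝ} (hs : 0 ≤ s) {f : ℂ → ℂ} (hf : ContinuousOn f (sphere 0 s)) :
    M s (fun z => (f z).re) = (M s f).re :=
  (Complex.reCLM.circleAverage_comp_comm (circInt hs hf))

theorem exists_log {f : ℂ → ℂ} {r : ℝ} (hr : 0 < r) (hf : DifferentiableOn ℂ f (ball 0 r))
    (hne : ∀ z ∈ ball (0:ℂ) r, f z ≠ 0) (L0 : ℂ) (hL0 : exp L0 = f 0) :
    ∃ L : ℂ → ℂ, DifferentiableOn ℂ L (ball 0 r) ∧ L 0 = L0 ∧ ∀ z ∈ ball (0:ℂ) r, exp (L z) = f z := by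
  have h1 : DifferentiableOn ℂ (fun z => deriv f z / f z) (ball 0 r) :=
    (hf.deriv isOpen_ball).div hf hne
  obtain ⟨g, hg⟩ := h1.isExactOn_ball
  have hm : (0:ℂ) ∈ ball (0:ℂ) r := by simpa using hr
  refine ⟨fun z => g z - g 0 + L0, ?_, by simp, ?_⟩
  · intro z hz
    exact (((hg z hz).sub_const _).add_const _).differentiableAt.differentiableWithinAt
  · have hd : ∀ z ∈ ball (0:ℂ) r, HasDerivAt (fun z => exp (-(g z - g 0 + L0)) * f z) 0 z := by
      intro z hz
      have a1 := (((hg z hz).sub_const (g 0)).add_const L0).neg.cexp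
      have a2 := (hf.differentiableAt (isOpen_ball.mem_nhds hz)).hasDerivAt
      refine (a1.mul a2).congr_deriv ?_
      have := hne z hz
      field_simp
      ring
    intro z hz
    have hc := (convex_ball (0:ℂ) r).is_const_of_fderivWithin_eq_zero (𝕜 := ℂ)
      (f := fun z => exp (-(g z - g 0 + L0)) * f z)
      (fun w hw => (hd w hw).differentiableAt.differentiableWithinAt) (fun w hw => by
        rw [fderivWithin_of_isOpen isOpen_ball hw]
        rw [(hd w hw).hasFDerivAt.fderiv]; ext; simp) hz hm
    simp only [sub_self, zero_add] at hc
    rw [← hL0, ← Complex.exp_add, neg_add_cancel, Complex.exp_zero, Complex.exp_neg] at hc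
    have := Complex.exp_ne_zero (g z - g 0 + L0)
    field_simp at hc
    exact hc.symm

theorem car_aux {p : ℂ → ℂ} {κ ε t : ℝ} (hp : DifferentiableOn ℂ p (ball 0 κ)) (hε : 0 < ε)
    (hre : ∀ z ∈ ball (0:ℂ) κ, 0 < (p z).re) (h0 : p 0 = ε) (ht0 : 0 ≤ t) (ht : t < 1) (hκ : 0 < κ)
    {z : ℂ} (hz : ‖z‖ ≤ t * κ) :
    (‖p z‖ ^ 2 + ε ^ 2) * (1 - t ^ 2) ≤ 2 * ε * (p z).re * (1 + t ^ 2) := by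
  have hn : ∀ z ∈ ball (0:ℂ) κ, p z + ε ≠ 0 := fun z hz h => by
    have := hre z hz
    have h2 := congrArg Complex.re h
    simp at h2; linarith
  have e1 : ∀ w : ℂ, ‖w - ε‖ ^ 2 = ‖w‖ ^ 2 - 2 * ε * w.re + ε ^ 2 := fun w => by
    rw [← Complex.normSq_eq_norm_sq, ← Complex.normSq_eq_norm_sq, Complex.normSq_apply, Complex.normSq_apply]
    simp; ring
  have e2 : ∀ w : ℂ, ‖w + ε‖ ^ 2 = ‖w‖ ^ 2 + 2 * ε * w.re + ε ^ 2 := fun w => by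
    rw [← Complex.normSq_eq_norm_sq, ← Complex.normSq_eq_norm_sq, Complex.normSq_apply, Complex.normSq_apply]
    simp; ring
  have hd : DifferentiableOn ℂ (fun z => (p z - ε) / (p z + ε)) (ball 0 κ) :=
    (hp.sub_const _).div (hp.add_const _) hn
  have hmaps : MapsTo (fun z => (p z - ε) / (p z + ε)) (ball 0 κ)
      (ball ((p 0 - ε) / (p 0 + ε)) 1) := by
    intro w hw
    rw [h0]
    have h1 := norm_pos_iff.mpr (hn w hw)
    simp only [sub_self, zero_div, mem_ball_zero_iff, norm_div]
    rw [div_lt_one h1]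
    refine lt_of_pow_lt_pow_left₀ 2 h1.le ?_
    rw [e1, e2]
    have := mul_pos hε (hre w hw)
    linarith
  have hzb : z ∈ ball (0:ℂ) κ := by
    simp only [mem_ball_zero_iff]; nlinarith
  have h1 := Complex.dist_le_div_mul_dist_of_mapsTo_ball hd (hmaps.mono_right ball_subset_closedBall) hzb
  have h2 := norm_pos_iff.mpr (hn z hzb)
  simp only [h0, sub_self, zero_div, dist_zero_right, norm_div] at h1
  rw [div_le_iff₀ h2] at h1
  have h3 : ‖p z - ε‖ ≤ t * ‖p z + ε‖ := by
    refine h1.trans (mul_le_mul_of_nonneg_right ?_ h2.le)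
    rw [one_div, inv_mul_le_iff₀ hκ]; linarith
  have h4 : ‖p z - ε‖ ^ 2 ≤ t ^ 2 * ‖p z + ε‖ ^ 2 := by
    rw [← mul_pow]; gcongr
  rw [e1, e2] at h4
  linarith

theorem car {p : ℂ → ℂ} {κ ε t : ℝ} (hp : DifferentiableOn ℂ p (ball 0 κ)) (hε : 0 ≤ ε)
    (hre : ∀ z ∈ ball (0:ℂ) κ, 0 ≤ (p z).re) (h0 : p 0 = ε) (ht0 : 0 ≤ t) (ht : t < 1) (hκ : 0 < κ)
    {z : ℂ} (hz : ‖z‖ ≤ t * κ) :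
    (‖p z‖ ^ 2 + ε ^ 2) * (1 - t ^ 2) ≤ 2 * ε * (p z).re * (1 + t ^ 2) := by
  have key : ∀ δ : ℝ, 0 < δ → (‖p z + δ‖ ^ 2 + (ε + δ) ^ 2) * (1 - t ^ 2) ≤
      2 * (ε + δ) * (p z + δ).re * (1 + t ^ 2) := fun δ hδ =>
    car_aux (p := fun z => p z + δ) (hp.add_const _) (by linarith)
      (fun w hw => by have := hre w hw; simp; linarith) (by simp [h0]) ht0 ht hκ hz
  have l1 : Tendsto (fun δ : ℝ => (‖p z + δ‖ ^ 2 + (ε + δ) ^ 2) * (1 - t ^ 2)) (𝓝[>] 0)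
      (𝓝 ((‖p z + (0:ℝ)‖ ^ 2 + (ε + 0) ^ 2) * (1 - t ^ 2))) :=
    (Continuous.tendsto (by fun_prop) 0).mono_left nhdsWithin_le_nhds
  have l2 : Tendsto (fun δ : ℝ => 2 * (ε + δ) * (p z + δ).re * (1 + t ^ 2)) (𝓝[>] 0)
      (𝓝 (2 * (ε + 0) * (p z + (0:ℝ)).re * (1 + t ^ 2))) :=
    (Continuous.tendsto (by fun_prop) 0).mono_left nhdsWithin_le_nhds
  have := le_of_tendsto_of_tendsto l1 l2 (by
    filter_upwards [self_mem_nhdsWithin] with δ hδ using key δ hδ)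
  simpa using this

theorem car_bound {p : ℂ → ℂ} {κ ε t : ℝ} (hp : DifferentiableOn ℂ p (ball 0 κ)) (hε : 0 ≤ ε)
    (hre : ∀ z ∈ ball (0:ℂ) κ, 0 ≤ (p z).re) (h0 : p 0 = ε) (ht0 : 0 ≤ t) (ht : t < 1) (hκ : 0 < κ)
    {z : ℂ} (hz : ‖z‖ ≤ t * κ) : ‖p z‖ ≤ 4 / (1 - t ^ 2) * ε := by
  have h1 := car hp hε hre h0 ht0 ht hκ hz
  have h2 : 0 < 1 - t ^ 2 := by nlinarith
  have h3 : (p z).re ≤ ‖p z‖ := Complex.re_le_norm _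
  rw [div_mul_eq_mul_div, le_div_iff₀ h2]
  rcases eq_or_lt_of_le (norm_nonneg (p z)) with h4 | h4
  · rw [← h4]; simp; exact hε
  · refine le_of_mul_le_mul_left ?_ h4
    have h5 : 0 ≤ ε ^ 2 * (1 - t ^ 2) := by positivity
    have h6 : 2 * ε * (p z).re * (1 + t ^ 2) ≤ 2 * ε * ‖p z‖ * 2 := by
      have a : 2 * ε * (p z).re ≤ 2 * ε * ‖p z‖ := by gcongr
      have b : 1 + t ^ 2 ≤ 2 := by nlinarith
      exact (mul_le_mul_of_nonneg_right a (by positivity)).trans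
        (mul_le_mul_of_nonneg_left b (by positivity))
    nlinarith

theorem exp_quad {x : ℂ} (hx : 0 ≤ x.re) : ‖exp (-x) - 1 + x‖ ≤ 3 * ‖x‖ ^ 2 := by
  by_cases h : ‖x‖ ≤ 1
  · have := Complex.norm_exp_sub_one_sub_id_le (x := -x) (by simpa using h)
    rw [norm_neg, sub_neg_eq_add] at this
    nlinarith [sq_nonneg ‖x‖]
  · push Not at h
    have h1 : ‖exp (-x)‖ ≤ 1 := by
      rw [Complex.norm_exp]; simpa using hx
    have h2 : ‖exp (-x) - 1 + x‖ ≤ ‖exp (-x)‖ + 1 + ‖x‖ := by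
      refine (norm_add_le _ _).trans ?_
      gcongr
      refine (norm_sub_le _ _).trans ?_
      simp
    nlinarith

end Bohr


namespace Bohr
open Complex Metric Set Filter Topology
open scoped ComplexConjugate

noncomputable def K1 (x : ℝ) : ℝ := ∑' k : ℕ, (k : ℝ) * x ^ k
noncomputable def K2 (x : ℝ) : ℝ := ∑' k : ℕ, (k : ℝ) ^ 2 * x ^ k

theorem K1_s {x : ℝ} (h0 : 0 ≤ x) (h1 : x < 1) : Summable (fun k : ℕ => (k : ℝ) * x ^ k) := by
  simpa using summable_pow_mul_geometric_of_norm_lt_one (R := ℝ) 1 (r := x)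
    (by rwa [Real.norm_eq_abs, abs_of_nonneg h0])

theorem K2_s {x : ℝ} (h0 : 0 ≤ x) (h1 : x < 1) : Summable (fun k : ℕ => (k : ℝ) ^ 2 * x ^ k) :=
  summable_pow_mul_geometric_of_norm_lt_one (R := ℝ) 2 (r := x)
    (by rwa [Real.norm_eq_abs, abs_of_nonneg h0])

theorem K1_nn {x : ℝ} (h0 : 0 ≤ x) : 0 ≤ K1 x := tsum_nonneg fun k => by positivity
theorem K2_nn {x : ℝ} (h0 : 0 ≤ x) : 0 ≤ K2 x := tsum_nonneg fun k => by positivity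

theorem norm_hasSum_le {f : ℕ → ℂ} {a : ℂ} {B : ℕ → ℝ} (h : HasSum f a) (hB : Summable B)
    (hb : ∀ k, ‖f k‖ ≤ B k) : ‖a‖ ≤ ∑' k, B k := by
  rw [← h.tsum_eq]; exact tsum_of_norm_bounded hB.hasSum hb

theorem coeff_bd {r r1 A : ℝ} {z : ℂ} {c : ℂ} {k : ℕ} (hr : 0 < r)
    (hz : ‖z‖ ≤ r1) (hc : ‖c‖ * r ^ k ≤ A) : ‖c * z ^ k‖ ≤ A * (r1 / r) ^ k := by
  have h1 : 0 ≤ r1 := (norm_nonneg z).trans hz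
  rw [norm_mul, norm_pow, div_pow, ← mul_div_assoc, le_div_iff₀ (by positivity)]
  calc ‖c‖ * ‖z‖ ^ k * r ^ k = (‖c‖ * r ^ k) * ‖z‖ ^ k := by ring
    _ ≤ A * r1 ^ k := by
      have : 0 ≤ A := le_trans (by positivity) hc
      gcongr

theorem zderiv_bd {c : ℕ → ℂ} {r r1 A : ℝ} {Q : ℂ → ℂ} (h : PS c r Q) (hA : ∀ k, ‖c k‖ * r ^ k ≤ A)
    (hr1 : r1 < r) {z : ℂ} (hz : ‖z‖ ≤ r1) : ‖z * deriv Q z‖ ≤ A * K1 (r1 / r) := by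
  have h1 : 0 ≤ r1 := (norm_nonneg z).trans hz
  have hr : 0 < r := h1.trans_lt hr1
  have hx : r1 / r < 1 := (div_lt_one hr).mpr hr1
  have := norm_hasSum_le (B := fun k => A * (k * (r1 / r) ^ k)) (h.zderiv z (hz.trans_lt hr1))
    ((K1_s (by positivity) hx).mul_left A) (fun k => by
      have := coeff_bd hr hz (hA k)
      rw [mul_assoc, norm_mul, Complex.norm_natCast]
      calc _ ≤ (k : ℝ) * (A * (r1 / r) ^ k) := by gcongr
        _ = _ := by ring)
  rwa [tsum_mul_left] at this

theorem E_bd {c : ℕ → ℂ} {r r1 A : ℝ} {Q : ℂ → ℂ} (h : PS c r Q) (hA : ∀ k, ‖c k‖ * r ^ k ≤ A)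
    (hr1 : r1 < r) {z x : ℂ} (hz : ‖z‖ ≤ r1) (hx : 0 ≤ x.re) :
    ‖Q (z * exp (-x)) - Q z + z * deriv Q z * x‖ ≤ 3 * A * K2 (r1 / r) * ‖x‖ ^ 2 := by
  have h1 : 0 ≤ r1 := (norm_nonneg z).trans hz
  have hr : 0 < r := h1.trans_lt hr1
  have hq : r1 / r < 1 := (div_lt_one hr).mpr hr1
  have hzr := hz.trans_lt hr1
  have hz2 : ‖z * exp (-x)‖ < r := by
    refine lt_of_le_of_lt ?_ hzr
    rw [norm_mul, Complex.norm_exp]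
    refine mul_le_of_le_one_right (norm_nonneg _) ?_
    simpa using hx
  have H := ((h _ hz2).sub (h _ hzr)).add ((h.zderiv z hzr).mul_right x)
  have H2 : HasSum (fun k : ℕ => c k * z ^ k * (exp (-(k * x)) - 1 + k * x))
      (Q (z * exp (-x)) - Q z + z * deriv Q z * x) := by
    refine hs_congr H fun k => ?_
    rw [mul_pow, ← Complex.exp_nat_mul, mul_neg]; ring
  have := norm_hasSum_le (B := fun k => (3 * A * ‖x‖ ^ 2) * (k ^ 2 * (r1 / r) ^ k)) H2
    ((K2_s (by positivity) hq).mul_left _) (fun k => by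
      have h2 := coeff_bd hr hz (hA k)
      have h3 : ‖exp (-(k * x)) - 1 + k * x‖ ≤ 3 * ‖(k : ℂ) * x‖ ^ 2 := by
        apply exp_quad; simp; positivity
      rw [norm_mul, Complex.norm_natCast] at h3
      rw [norm_mul]
      calc _ ≤ (A * (r1 / r) ^ k) * (3 * (k * ‖x‖) ^ 2) :=
            mul_le_mul h2 h3 (norm_nonneg _) (le_trans (norm_nonneg _) h2)
        _ = _ := by ring)
  rw [tsum_mul_left] at this
  refine this.trans (le_of_eq ?_)
  unfold K2; ring

noncomputable def D (c : ℕ → ℂ) (ρ : ℝ) : ℝ := ∑' k : ℕ, (k : ℝ) * ‖c k‖ ^ 2 * ρ ^ k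
noncomputable def ell (ρ : ℝ) : ℝ := - Real.log (1 - ρ)

theorem D_s {c : ℕ → ℂ} {r A ρ : ℝ} (hr : 0 < r) (hA : ∀ k, ‖c k‖ * r ^ k ≤ A) (hρ : 0 ≤ ρ)
    (hρr : ρ < r ^ 2) : Summable (fun k : ℕ => (k : ℝ) * ‖c k‖ ^ 2 * ρ ^ k) := by
  have h1 : ρ / r ^ 2 < 1 := (div_lt_one (by positivity)).mpr hρr
  refine Summable.of_nonneg_of_le (fun k => by positivity) (fun k => ?_)
    ((K1_s (x := ρ / r ^ 2) (by positivity) h1).mul_left (A ^ 2))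
  have : (‖c k‖ * r ^ k) ^ 2 ≤ A ^ 2 := by
    have := hA k
    gcongr
  calc (k : ℝ) * ‖c k‖ ^ 2 * ρ ^ k = (‖c k‖ * r ^ k) ^ 2 * (k * (ρ / r ^ 2) ^ k) := by
        rw [div_pow]; field_simp; ring
    _ ≤ _ := by gcongr

/-- The `ell` comparison. -/
theorem ell_step {ρ ε : ℝ} (hρ : 0 ≤ ρ) (hρ1 : ρ < 1) (hε : 0 ≤ ε) :
    4 * ε * ρ / (1 + ρ) ≤ 4 * (ell ρ - ell (ρ - ε * (1 - ρ) / (1 + ρ) * ρ)) + 4 * ε ^ 2 := by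
  set x := ε * ρ / (1 + ρ) with hx
  have hx0 : 0 ≤ x := by positivity
  have hxε : x ≤ ε := by
    rw [hx, div_le_iff₀ (by positivity)]; nlinarith
  have e : ell ρ - ell (ρ - ε * (1 - ρ) / (1 + ρ) * ρ) = Real.log (1 + x) := by
    unfold ell
    have h1 : 1 - ρ ≠ 0 := by linarith
    have h2 : 1 + x ≠ 0 := by positivity
    have : 1 - (ρ - ε * (1 - ρ) / (1 + ρ) * ρ) = (1 - ρ) * (1 + x) := by
      rw [hx]; field_simp; ring
    rw [this, Real.log_mul h1 h2]; ring
  rw [e]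
  have h1 := Real.one_sub_inv_le_log_of_pos (x := 1 + x) (by positivity)
  have h2 : x - x ^ 2 ≤ 1 - (1 + x)⁻¹ := by
    have : 1 - (1 + x)⁻¹ = x / (1 + x) := by field_simp; ring
    rw [this, le_div_iff₀ (by positivity)]
    nlinarith [pow_nonneg hx0 3]
  have h3 : 4 * ε * ρ / (1 + ρ) = 4 * x := by rw [hx]; ring
  rw [h3]
  nlinarith

theorem D_shift {c : ℕ → ℂ} {r A ρ η S : ℝ} (hr : 0 < r) (hA : ∀ k, ‖c k‖ * r ^ k ≤ A) (hρ : 0 ≤ ρ)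
    (hρr : ρ < r ^ 2) (hη : 0 ≤ η) (hη1 : η ≤ 1)
    (hS : HasSum (fun k : ℕ => (k : ℝ) ^ 2 * ‖c k‖ ^ 2 * ρ ^ k) S) :
    D c ρ - η * S ≤ D c (ρ - η * ρ) := by
  have h1 := (D_s hr hA hρ hρr).hasSum
  have hρ2 : 0 ≤ ρ - η * ρ := by nlinarith
  have h2 := (D_s (ρ := ρ - η * ρ) hr hA hρ2 (by nlinarith)).hasSum
  refine hasSum_le (fun k => ?_) (h1.sub (hS.mul_left η)) h2
  have h3 : 1 + (k : ℝ) * (-η) ≤ (1 + -η) ^ k := one_add_mul_le_pow (by linarith) k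
  have h4 : (ρ - η * ρ) ^ k = ρ ^ k * (1 + -η) ^ k := by rw [← mul_pow]; ring
  rw [h4]
  have h5 : 0 ≤ (k : ℝ) * ‖c k‖ ^ 2 * ρ ^ k := by positivity
  nlinarith [mul_le_mul_of_nonneg_left h3 h5]

end Bohr


namespace Bohr
open Complex Metric Set Filter Topology
open scoped ComplexConjugate

theorem PS_u {c : ℕ → ℂ} {r : ℝ} {Q : ℂ → ℂ} (h : PS c r Q) :
    PS (fun k => (if k = 0 then 1 else 0) + k * c k) r (fun z => 1 + z * deriv Q z) :=
  (PS_const 1 r).add h.zderiv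

theorem key1 {c v : ℕ → ℂ} {r σ ε : ℝ} {Q p : ℂ → ℂ} (h : PS c r Q) (hσ : 0 ≤ σ) (hσr : σ < r)
    (hp : DifferentiableOn ℂ p (ball 0 r)) (h0 : p 0 = ε)
    (hv : PS v r (fun z => (1 + z * deriv Q z) * p z - ε)) :
    HasSum (fun k : ℕ => (k : ℝ) * (conj (c k) * v k).re * (σ ^ 2) ^ k)
      (M σ (fun z => ‖1 + z * deriv Q z‖ ^ 2 * (p z).re) - ε) := by
  have h1 := h.zderiv.parseval hv hσ hσr
  have hu := (PS_u h)
  have cu := hu.contOn hσr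
  have cp : ContinuousOn p (sphere 0 σ) :=
    hp.continuousOn.mono (sphere_subset_closedBall.trans (closedBall_subset_ball hσr))
  have cc : ContinuousOn (fun z => conj (1 + z * deriv Q z)) (sphere 0 σ) :=
    Complex.continuous_conj.comp_continuousOn cu
  have cP : ContinuousOn (fun z => (((‖1 + z * deriv Q z‖ ^ 2 : ℝ)) : ℂ) * p z) (sphere 0 σ) := by
    refine ContinuousOn.mul ?_ cp
    exact Complex.continuous_ofReal.comp_continuousOn (cu.norm.pow 2)
  have e : M σ (fun z => conj (z * deriv Q z) * ((1 + z * deriv Q z) * p z - ε)) =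
      M σ (fun z => (((‖1 + z * deriv Q z‖ ^ 2 : ℝ)) : ℂ) * p z) - ε := by
    rw [M_congr hσ (g := fun z => ((((‖1 + z * deriv Q z‖ ^ 2 : ℝ)) : ℂ) * p z -
      ε * conj (1 + z * deriv Q z)) - ((1 + z * deriv Q z) * p z - ε))]
    · rw [M_sub hσ, M_sub hσ cP, M_const_mul, M_conj, M_analytic hσ hσr hu.diff,
        M_analytic hσ hσr hv.diff]
      · simp [h0]
      · exact continuousOn_const.mul cc
      · exact cP.sub (continuousOn_const.mul cc)
      · exact hv.contOn hσr
    · intro z hz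
      have : ((‖1 + z * deriv Q z‖ ^ 2 : ℝ) : ℂ) = conj (1 + z * deriv Q z) * (1 + z * deriv Q z) := by
        rw [Complex.conj_mul']; push_cast; rfl
      rw [this]
      simp only [map_add, map_one]
      ring
  rw [e] at h1
  have h2 := Complex.hasSum_re h1
  have e2 : (M σ (fun z => (((‖1 + z * deriv Q z‖ ^ 2 : ℝ)) : ℂ) * p z) - ε).re =
      M σ (fun z => ‖1 + z * deriv Q z‖ ^ 2 * (p z).re) - ε := by
    rw [Complex.sub_re, ← M_re hσ cP, Complex.ofReal_re]
    simp only [Complex.re_ofReal_mul]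
  rw [e2] at h2
  convert h2 using 1
  funext k
  rw [Complex.re_mul_ofReal, map_mul, Complex.conj_natCast, ← Complex.ofReal_natCast, mul_assoc ((k:ℝ):ℂ),
    Complex.re_ofReal_mul, pow_mul]

theorem key2 {c : ℕ → ℂ} {r σ ε κ t : ℝ} {Q p : ℂ → ℂ} (h : PS c r Q) (hσ : 0 ≤ σ) (hσr : σ < r)
    (hrκ : r ≤ κ) (hp : DifferentiableOn ℂ p (ball 0 κ)) (h0 : p 0 = ε) (hε : 0 ≤ ε)
    (hre : ∀ z ∈ ball (0:ℂ) κ, 0 ≤ (p z).re) (ht : σ = t * κ) :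
    ∃ S : ℝ, HasSum (fun k : ℕ => (k : ℝ) ^ 2 * ‖c k‖ ^ 2 * (σ ^ 2) ^ k) S ∧
      1 + S = M σ (fun z => ‖1 + z * deriv Q z‖ ^ 2) ∧
      ε * ((1 - t ^ 2) / (1 + t ^ 2)) * (2 + S) ≤
        2 * M σ (fun z => ‖1 + z * deriv Q z‖ ^ 2 * (p z).re) := by
  have hκ : 0 < κ := by linarith
  have ht0 : 0 ≤ t := by
    by_contra hc; push Not at hc; nlinarith
  have ht1 : t < 1 := by
    by_contra hc; push Not at hc; nlinarith
  have hu := PS_u h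
  have cu := hu.contOn hσr
  have cp : ContinuousOn p (sphere 0 σ) :=
    hp.continuousOn.mono (sphere_subset_closedBall.trans (closedBall_subset_ball (by linarith)))
  have cre : ContinuousOn (fun z => (p z).re) (sphere 0 σ) :=
    Complex.continuous_re.comp_continuousOn cp
  have cu2 : ContinuousOn (fun z => ‖1 + z * deriv Q z‖ ^ 2) (sphere 0 σ) := cu.norm.pow 2
  have cp2 : ContinuousOn (fun z => ‖p z‖ ^ 2) (sphere 0 σ) := cp.norm.pow 2
  have h1 := h.zderiv.parseval_sq hσ hσr
  have h2 := hu.parseval_sq hσ hσr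
  refine ⟨M σ (fun z => ‖z * deriv Q z‖ ^ 2), ?_, ?_, ?_⟩
  · convert h1 using 1
    funext k
    rw [norm_mul, Complex.norm_natCast, mul_pow, pow_mul]
  · have h3 : HasSum (fun k : ℕ => if k = 0 then (1:ℝ) else 0) 1 := hasSum_ite_eq 0 1
    refine HasSum.unique ?_ h2
    convert h3.add h1 using 1
    funext k
    rcases k with _ | k <;> simp
  · have hS : 1 + M σ (fun z => ‖z * deriv Q z‖ ^ 2) = M σ (fun z => ‖1 + z * deriv Q z‖ ^ 2) := by
      have h3 : HasSum (fun k : ℕ => if k = 0 then (1:ℝ) else 0) 1 := hasSum_ite_eq 0 1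
      refine HasSum.unique ?_ h2
      convert h3.add h1 using 1
      funext k
      rcases k with _ | k <;> simp
    rcases hε.eq_or_lt with he | he
    · subst he
      simp only [zero_mul]
      have : M σ (fun _ : ℂ => (0:ℝ)) ≤ M σ (fun z => ‖1 + z * deriv Q z‖ ^ 2 * (p z).re) :=
        M_mono hσ continuousOn_const (cu2.mul cre) (fun z hz => by
          have := hre z (by simp only [mem_ball_zero_iff]; linarith)
          positivity)
      rw [M_constR] at this
      linarith
    · -- Car averaged
      have hm : M σ (fun z => (1 - t ^ 2) * (‖(1 + z * deriv Q z) * p z‖ ^ 2 +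
            ε ^ 2 * ‖1 + z * deriv Q z‖ ^ 2)) ≤
          M σ (fun z => (2 * ε * (1 + t ^ 2)) * (‖1 + z * deriv Q z‖ ^ 2 * (p z).re)) := by
        refine M_mono hσ ?_ (continuousOn_const.mul (cu2.mul cre)) ?_
        · exact continuousOn_const.mul (((cu.mul cp).norm.pow 2).add (continuousOn_const.mul cu2))
        · intro z hz
          have := car hp hε hre h0 ht0 ht1 hκ (z := z) (by linarith)
          rw [norm_mul, mul_pow]
          have h5 : 0 ≤ ‖1 + z * deriv Q z‖ ^ 2 := by positivity
          nlinarith [mul_le_mul_of_nonneg_left this h5]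
      have ma : M σ (fun z => ‖(1 + z * deriv Q z) * p z‖ ^ 2 + ε ^ 2 * ‖1 + z * deriv Q z‖ ^ 2) =
          M σ (fun z => ‖(1 + z * deriv Q z) * p z‖ ^ 2) +
          M σ (fun z => ε ^ 2 * ‖1 + z * deriv Q z‖ ^ 2) :=
        M_add hσ ((cu.mul cp).norm.pow 2) (continuousOn_const.mul cu2)
      rw [M_const_mulR, M_const_mulR, ma, M_const_mulR, ← hS] at hm
      obtain ⟨y, hy⟩ := exists_PS (f := fun z => (1 + z * deriv Q z) * p z) (r := r)
        (hu.diff.mul (hp.mono (ball_subset_ball hrκ)))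
      have hy1 := le_hasSum (hy.parseval_sq hσ hσr) 0 (fun j _ => by positivity)
      have hy0 := hy.zero_val (by linarith)
      have : ‖y 0‖ ^ 2 = ε ^ 2 := by
        rw [← hy0, h0]; simp
      rw [this] at hy1
      simp only [mul_zero, pow_zero, mul_one] at hy1
      have ht2 : 0 < 1 - t ^ 2 := by nlinarith
      rw [← mul_div_assoc, div_mul_eq_mul_div, div_le_iff₀ (by positivity)]
      refine le_of_mul_le_mul_left ?_ he
      nlinarith [mul_le_mul_of_nonneg_left hy1 ht2.le]

theorem frac_bd {ρ κ δ : ℝ} (hρ : 0 ≤ ρ) (hρ1 : ρ ≤ 1) (hκ : 1 / 2 ≤ κ) (hκδ : 1 - δ ≤ κ) (hδ : 0 ≤ δ) (hδ1 : δ ≤ 1 / 2) :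
    (1 - ρ) / (1 + ρ) - 16 * δ ≤ (1 - ρ / κ ^ 2) / (1 + ρ / κ ^ 2) := by
  have hk2 : 1 / 4 ≤ κ ^ 2 := by nlinarith
  have e : (1 - ρ / κ ^ 2) / (1 + ρ / κ ^ 2) = (κ ^ 2 - ρ) / (κ ^ 2 + ρ) := by
    have : κ ≠ 0 := by linarith
    field_simp
  have hk : 1 - 2 * δ ≤ κ ^ 2 := by nlinarith
  rw [e]
  have h1 : (1 - ρ) / (1 + ρ) = 1 - 2 * ρ / (1 + ρ) := by field_simp; ring
  have h2 : (κ ^ 2 - ρ) / (κ ^ 2 + ρ) = 1 - 2 * ρ / (κ ^ 2 + ρ) := by field_simp; ring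
  rw [h1, h2]
  have h3 : 2 * ρ / (κ ^ 2 + ρ) ≤ 2 * ρ / (1 + ρ) + 16 * δ := by
    rw [div_add' _ _ _ (by positivity), div_le_div_iff₀ (by positivity) (by positivity)]
    nlinarith [mul_nonneg hδ hρ, mul_nonneg (mul_nonneg hδ hρ) hρ, mul_nonneg hδ (sub_nonneg.mpr hk2), mul_nonneg (mul_nonneg hδ hρ) (sub_nonneg.mpr hk2)]
  linarith

end Bohr


namespace Bohr
open Complex Metric Set Filter Topology
open scoped ComplexConjugate

theorem sq_expand (c v e : ℂ) : ‖c - v + e‖ ^ 2 ≤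
    ‖c‖ ^ 2 - 2 * (conj c * v).re + (2 * ‖c‖ * ‖e‖ + (‖v‖ + ‖e‖) ^ 2) := by
  have h1 : ‖c - v + e‖ ^ 2 = ‖c‖ ^ 2 - 2 * (conj c * v).re + 2 * (conj c * e).re + ‖e - v‖ ^ 2 := by
    simp only [← Complex.normSq_eq_norm_sq, Complex.normSq_apply]
    simp; ring
  have h2 : (conj c * e).re ≤ ‖c‖ * ‖e‖ := by
    refine (Complex.re_le_norm _).trans ?_
    rw [norm_mul, RCLike.norm_conj]
  have h3 : ‖e - v‖ ^ 2 ≤ (‖v‖ + ‖e‖) ^ 2 := by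
    have := norm_sub_le e v
    gcongr
    linarith
  rw [h1]; linarith

theorem term_bd {x y w r1 ρ s ε A C1 C2 : ℝ} {k : ℕ} (hx : 0 ≤ x) (hy : 0 ≤ y) (hw : 0 ≤ w)
    (hr : 0 < r1) (hρ : 0 ≤ ρ) (hρs : ρ ≤ s ^ 2) (hε : 0 ≤ ε) (hε1 : ε ≤ 1) (hA : 0 ≤ A) (hC1 : 0 ≤ C1)
    (hC2 : 0 ≤ C2) (a1 : x * r1 ^ k ≤ A) (a2 : y * r1 ^ k ≤ C2 * ε) (a3 : w * r1 ^ k ≤ C1 * ε ^ 2) :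
    (2 * x * w + (y + w) ^ 2) * ρ ^ k ≤
      (2 * A * C1 + (C2 + C1) ^ 2) * ε ^ 2 * (s ^ 2 / r1 ^ 2) ^ k := by
  have hrk : 0 < r1 ^ k := by positivity
  have a4 : w * r1 ^ k ≤ C1 * ε := a3.trans (by
    apply mul_le_mul_of_nonneg_left _ hC1; nlinarith)
  have b1 : (x * r1 ^ k) * (w * r1 ^ k) ≤ A * (C1 * ε ^ 2) :=
    mul_le_mul a1 a3 (by positivity) hA
  have b2 : (y * r1 ^ k + w * r1 ^ k) ^ 2 ≤ (C2 * ε + C1 * ε) ^ 2 :=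
    pow_le_pow_left₀ (by positivity) (by linarith) 2
  have h3 : ρ ^ k ≤ (r1 ^ k) ^ 2 * (s ^ 2 / r1 ^ 2) ^ k := by
    have : (r1 ^ k) ^ 2 * (s ^ 2 / r1 ^ 2) ^ k = (s ^ 2) ^ k := by
      rw [div_pow]; field_simp; ring
    rw [this]; exact pow_le_pow_left₀ hρ hρs k
  have h0 : 0 ≤ 2 * x * w + (y + w) ^ 2 := by positivity
  have h5 : 0 ≤ (s ^ 2 / r1 ^ 2) ^ k := by positivity
  calc _ ≤ (2 * x * w + (y + w) ^ 2) * ((r1 ^ k) ^ 2 * (s ^ 2 / r1 ^ 2) ^ k) :=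
        mul_le_mul_of_nonneg_left h3 h0
    _ = (2 * ((x * r1 ^ k) * (w * r1 ^ k)) + (y * r1 ^ k + w * r1 ^ k) ^ 2) * (s ^ 2 / r1 ^ 2) ^ k := by ring
    _ ≤ (2 * (A * (C1 * ε ^ 2)) + (C2 * ε + C1 * ε) ^ 2) * (s ^ 2 / r1 ^ 2) ^ k :=
        mul_le_mul_of_nonneg_right (by linarith) h5
    _ = _ := by ring

set_option maxHeartbeats 1600000 in
theorem onestep {s r A : ℝ} (hs : 0 ≤ s) (hsr : s < r) (hr1 : r < 1) (hA : 0 ≤ A) :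
    ∃ C δ0 : ℝ, 0 ≤ C ∧ 0 < δ0 ∧ ∀ (ρ ε δ κ : ℝ) (c d : ℕ → ℂ) (Q p q : ℂ → ℂ),
      0 ≤ ρ → ρ ≤ s ^ 2 → 0 ≤ ε → ε ≤ δ → δ ≤ δ0 → 1 - δ ≤ κ → PS c r Q →
      (∀ k, ‖c k‖ * r ^ k ≤ A) → DifferentiableOn ℂ p (ball 0 κ) →
      (∀ z ∈ ball (0:ℂ) κ, 0 ≤ (p z).re) → p 0 = ε → PS d r q →
      (∀ z, ‖z‖ < r → q z = Q (z * exp (-p z)) - (p z - ε)) →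
      D d ρ - 4 * ell ρ ≤ D c (ρ - ε * (1 - ρ) / (1 + ρ) * ρ) -
        4 * ell (ρ - ε * (1 - ρ) / (1 + ρ) * ρ) + C * (ε * δ) := by
  have hr : 0 < r := by linarith
  set r1 := (s + r) / 2 with hr1d
  have hr1r : r1 < r := by rw [hr1d]; linarith
  have hsr1 : s < r1 := by rw [hr1d]; linarith
  have hr10 : 0 < r1 := by linarith
  set B := 4 / (1 - (2 * r / (1 + r)) ^ 2) with hB
  have htt0 : 0 ≤ 2 * r / (1 + r) := by positivity
  have htt : 2 * r / (1 + r) < 1 := by rw [div_lt_one (by linarith)]; linarith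
  have hB0 : 0 ≤ B := by
    have : 0 < 1 - (2 * r / (1 + r)) ^ 2 := by nlinarith
    positivity
  set C1 := 3 * A * K2 (r1 / r) * B ^ 2 with hC1
  have hC10 : 0 ≤ C1 := by have := K2_nn (x := r1 / r) (by positivity); positivity
  set A1 := A * K1 (r1 / r) with hA1
  have hA10 : 0 ≤ A1 := by have := K1_nn (x := r1 / r) (by positivity); positivity
  set C2 := (1 + A1) * B + 1 with hC2
  have hC20 : 0 ≤ C2 := by positivity
  set C3 := 2 * A * C1 + (C2 + C1) ^ 2 with hC3
  have hC30 : 0 ≤ C3 := by positivity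
  set K := K1 (s ^ 2 / r1 ^ 2) with hK
  have hK0 : 0 ≤ K := K1_nn (by positivity)
  clear_value K C3 C2 A1 C1 B r1
  refine ⟨C3 * K + 16 * (1 + (1 + A1) ^ 2) + 4, (1 - r) / 2, by positivity, by linarith, ?_⟩
  intro ρ ε δ κ c d Q p q hρ hρs hε hεδ hδ hκ hc hcA hp hre hp0 hd hq
  have hδ2 : δ ≤ 1 / 2 := by linarith
  have hε1 : ε ≤ 1 := by linarith
  have hκm : (1 + r) / 2 ≤ κ := by linarith
  have hrκ : r ≤ κ := by linarith
  have hpr : DifferentiableOn ℂ p (ball 0 r) := hp.mono (ball_subset_ball hrκ)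
  have hrer : ∀ z, ‖z‖ < r → 0 ≤ (p z).re := fun z hz => hre z (by simp only [mem_ball_zero_iff]; linarith)
  have hpb : ∀ z, ‖z‖ < r → ‖p z‖ ≤ B * ε := fun z hz => by
    rw [hB]
    exact car_bound (hp.mono (ball_subset_ball hκm)) hε
      (fun z hz => hre z (ball_subset_ball hκm hz)) hp0 htt0 htt (by linarith) (by
        rw [div_mul_div_comm, mul_comm (1 + r), mul_div_mul_right _ _ (by linarith)]; linarith)
  have hu := PS_u hc
  obtain ⟨v, hv⟩ := exists_PS (f := fun z => (1 + z * deriv Q z) * p z - ε) (r := r)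
        ((hu.diff.mul hpr).sub_const _)
  set e : ℕ → ℂ := fun k => d k - c k + v k with he
  have hE : PS e r (fun z => q z - Q z + ((1 + z * deriv Q z) * p z - ε)) := (hd.sub hc).add hv
  have hvb : ∀ k, ‖v k‖ * r1 ^ k ≤ C2 * ε := hv.cauchy hr10.le hr1r (fun z hz => by
    have h1 := zderiv_bd hc hcA hr1r (z := z) hz.le
    rw [← hA1] at h1
    have h2 := hpb z (by linarith)
    have h3 : ‖1 + z * deriv Q z‖ ≤ 1 + A1 := (norm_add_le _ _).trans (by simpa using h1)
    refine (norm_sub_le _ _).trans ?_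
    rw [norm_mul, Complex.norm_real, Real.norm_eq_abs, abs_of_nonneg hε]
    have := mul_le_mul h3 h2 (norm_nonneg _) (by positivity)
    rw [hC2]; linarith)
  have heb : ∀ k, ‖e k‖ * r1 ^ k ≤ C1 * ε ^ 2 := hE.cauchy hr10.le hr1r (fun z hz => by
    have hzr : ‖z‖ < r := by linarith
    have h1 := E_bd hc hcA hr1r (z := z) (x := p z) hz.le (hrer z hzr)
    have h2 := hpb z hzr
    have h3 : q z - Q z + ((1 + z * deriv Q z) * p z - ε) =
        Q (z * exp (-p z)) - Q z + z * deriv Q z * p z := by rw [hq z hzr]; ring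
    rw [h3]
    refine h1.trans ?_
    have h4 : ‖p z‖ ^ 2 ≤ (B * ε) ^ 2 := by gcongr
    have h5 := K2_nn (x := r1 / r) (by positivity)
    calc _ ≤ 3 * A * K2 (r1 / r) * (B * ε) ^ 2 := by gcongr
      _ = _ := by rw [hC1]; ring)
  have hcb : ∀ k, ‖c k‖ * r1 ^ k ≤ A := fun k => by
    refine le_trans ?_ (hcA k); gcongr
  have hdb : ∀ k, ‖d k‖ * r1 ^ k ≤ A + C2 * ε + C1 * ε ^ 2 := fun k => by
    have : d k = c k - v k + e k := by rw [he]; ring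
    have h1 : ‖d k‖ ≤ ‖c k‖ + ‖v k‖ + ‖e k‖ := by
      rw [this]
      exact (norm_add_le _ _).trans (by gcongr; exact norm_sub_le _ _)
    have h2 : ‖d k‖ * r1 ^ k ≤ (‖c k‖ + ‖v k‖ + ‖e k‖) * r1 ^ k := by gcongr
    have := hcb k; have := hvb k; have := heb k
    linarith
  set σ := Real.sqrt ρ with hσd
  have hσ : 0 ≤ σ := Real.sqrt_nonneg _
  have hσ2 : σ ^ 2 = ρ := Real.sq_sqrt hρ
  have hσs : σ ≤ s := Real.sqrt_le_iff.mpr ⟨hs, hρs⟩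
  have hρr1 : ρ < r1 ^ 2 := lt_of_le_of_lt hρs (by gcongr)
  have hρ1 : ρ < 1 := by nlinarith
  have H1 := key1 hc hσ (by linarith) hpr hp0 hv
  obtain ⟨S, HS, HS1, H2⟩ := key2 (t := σ / κ) hc hσ (by linarith) hrκ hp hp0 hε hre (by
    have : κ ≠ 0 := by linarith
    field_simp)
  rw [hσ2] at H1 HS
  rw [div_pow, hσ2] at H2
  set T := M σ (fun z => ‖1 + z * deriv Q z‖ ^ 2 * (p z).re) with hT
  clear_value T e σ
  -- upper bound of D d ρ
  have hKs : Summable (fun k : ℕ => (k : ℝ) * (s ^ 2 / r1 ^ 2) ^ k) := K1_s (by positivity) (by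
    rw [div_lt_one (by positivity)]; gcongr)
  have U : D d ρ ≤ D c ρ - 2 * (T - ε) + C3 * ε ^ 2 * K := by
    have hKh := hKs.hasSum.mul_left (C3 * ε ^ 2)
    rw [show (∑' k : ℕ, (k : ℝ) * (s ^ 2 / r1 ^ 2) ^ k) = K from hK.symm] at hKh
    refine hasSum_le (fun k => ?_) (D_s hr10 hdb hρ hρr1).hasSum
      (((D_s hr10 hcb hρ hρr1).hasSum.sub (H1.mul_left 2)).add hKh)
    have hdk : d k = c k - v k + e k := by rw [he]; ring
    have h1 := sq_expand (c k) (v k) (e k)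
    rw [← hdk] at h1
    have h4 : (2 * ‖c k‖ * ‖e k‖ + (‖v k‖ + ‖e k‖) ^ 2) * ρ ^ k ≤ C3 * ε ^ 2 * (s ^ 2 / r1 ^ 2) ^ k := by
      rw [hC3]
      exact term_bd (norm_nonneg _) (norm_nonneg _) (norm_nonneg _) hr10 hρ hρs hε hε1 hA hC10 hC20
        (hcb k) (hvb k) (heb k)
    have h5 := mul_le_mul_of_nonneg_right h1 (show 0 ≤ ρ ^ k by positivity)
    have h6 : ‖d k‖ ^ 2 * ρ ^ k ≤ (‖c k‖ ^ 2 - 2 * (conj (c k) * v k).re) * ρ ^ k +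
        C3 * ε ^ 2 * (s ^ 2 / r1 ^ 2) ^ k := by linarith
    have h7 := mul_le_mul_of_nonneg_left h6 (show (0:ℝ) ≤ k by positivity)
    linarith
  -- bound for S
  have hS0 : 0 ≤ S := HS.nonneg (fun k => by positivity)
  have hSb : 1 + S ≤ (1 + A1) ^ 2 := by
    rw [HS1, ← M_constR (s := σ) ((1 + A1) ^ 2)]
    refine M_mono hσ ((hu.contOn (by linarith)).norm.pow 2) continuousOn_const fun z hz => ?_
    have h1 := zderiv_bd hc hcA hr1r (z := z) (by linarith)
    rw [← hA1] at h1
    have h3 : ‖1 + z * deriv Q z‖ ≤ 1 + A1 := (norm_add_le _ _).trans (by simpa using h1)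
    gcongr
  set η := ε * (1 - ρ) / (1 + ρ) with hη
  have hη0 : 0 ≤ η := div_nonneg (mul_nonneg hε (by linarith)) (by linarith)
  have hηε : η ≤ ε := by rw [hη, div_le_iff₀ (by linarith)]; nlinarith
  have hf := frac_bd (ρ := ρ) (κ := κ) (δ := δ) hρ hρ1.le (by linarith) hκ (by linarith) hδ2
  have h8 : η * (2 + S) - 16 * (ε * δ) * (1 + (1 + A1) ^ 2) ≤ 2 * T := by
    refine le_trans ?_ H2
    have a1 := mul_le_mul_of_nonneg_left hf hε
    have a2 := mul_le_mul_of_nonneg_right a1 (show 0 ≤ 2 + S by linarith)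
    refine le_trans ?_ a2
    have a3 : ε * ((1 - ρ) / (1 + ρ) - 16 * δ) = η - 16 * (ε * δ) := by rw [hη]; ring
    rw [a3, sub_mul]
    have a4 : 0 ≤ 16 * (ε * δ) := by have := hε.trans hεδ; positivity
    have a5 := mul_le_mul_of_nonneg_left (show 2 + S ≤ 1 + (1 + A1) ^ 2 by linarith) a4
    linarith
  have h9 := D_shift hr10 hcb hρ hρr1 hη0 (by linarith) HS
  have h10 := ell_step hρ hρ1 hε
  have h11 : 2 * ε - 2 * η = 4 * ε * ρ / (1 + ρ) := by rw [hη]; field_simp; ring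
  have h12 : ε ^ 2 ≤ ε * δ := by nlinarith
  have h13 : C3 * ε ^ 2 * K ≤ C3 * (ε * δ) * K := by gcongr
  rw [← hη] at h10
  linarith

end Bohr


namespace Bohr
open Complex Metric Set Filter Topology
open scoped ComplexConjugate

structure US (φ : ℂ → ℂ) (m : ℝ) : Prop where
  diff : DifferentiableOn ℂ φ (ball 0 1)
  inj : InjOn φ (ball 0 1)
  maps : MapsTo φ (ball 0 1) (ball 0 1)
  zero : φ 0 = 0
  der : deriv φ 0 = m
  pos : 0 < m

theorem US.schwarz {φ : ℂ → ℂ} {m : ℝ} (h : US φ m) {z : ℂ} (hz : ‖z‖ < 1) : ‖φ z‖ ≤ ‖z‖ := by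
  apply Complex.norm_le_norm_of_mapsTo_ball h.diff (h.maps.mono_right ball_subset_closedBall) h.zero hz

theorem US.le_one {φ : ℂ → ℂ} {m : ℝ} (h : US φ m) : m ≤ 1 := by
  have := Complex.norm_deriv_le_one_of_mapsTo_ball h.diff
    (by rw [h.zero]; exact h.maps.mono_right ball_subset_closedBall) one_pos
  rw [h.der] at this
  simpa [abs_of_pos h.pos] using this

theorem US.ne_zero {φ : ℂ → ℂ} {m : ℝ} (h : US φ m) {z : ℂ} (hz : ‖z‖ < 1) (hz0 : z ≠ 0) : φ z ≠ 0 := by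
  intro h1
  rw [← h.zero] at h1
  exact hz0 (h.inj (by simpa using hz) (by simp) h1)

theorem US.dsl {φ : ℂ → ℂ} {m : ℝ} (h : US φ m) : DifferentiableOn ℂ (dslope φ 0) (ball 0 1) ∧
    dslope φ 0 0 = m ∧ (∀ z : ℂ, z * dslope φ 0 z = φ z) ∧ ∀ z ∈ ball (0:ℂ) 1, dslope φ 0 z ≠ 0 := by
  have e : ∀ z : ℂ, z * dslope φ 0 z = φ z := fun z => by
    have := sub_smul_dslope φ 0 z
    simpa [h.zero] using this
  have e0 : dslope φ 0 0 = m := by rw [dslope_same, h.der]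
  refine ⟨(Complex.differentiableOn_dslope (ball_mem_nhds 0 one_pos)).mpr h.diff, e0, e, ?_⟩
  intro z hz h1
  by_cases hz0 : z = 0
  · rw [hz0, e0] at h1
    have := h.pos
    norm_cast at h1; linarith
  · have := e z
    rw [h1, mul_zero] at this
    exact h.ne_zero (by simpa using hz) hz0 this.symm

/-- openness of the image of open sets -/
theorem US.isOpen {φ : ℂ → ℂ} {m : ℝ} (h : US φ m) {s : Set ℂ} (hs : s ⊆ ball 0 1) (ho : IsOpen s) :
    IsOpen (φ '' s) := by
  rcases (h.diff.analyticOnNhd isOpen_ball).is_constant_or_isOpen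
    (convex_ball (0:ℂ) 1).isPreconnected with ⟨w, hw⟩ | hw
  · exfalso
    have h1 : (1/2 : ℂ) ∈ ball (0:ℂ) 1 := by simp; norm_num
    have := h.inj h1 (show (0:ℂ) ∈ ball (0:ℂ) 1 by simp) (by rw [hw _ h1, hw 0 (by simp)])
    norm_num at this
  · exact hw s hs ho

theorem US.inv {φ : ℂ → ℂ} {m : ℝ} (h : US φ m) : ∃ g : ℂ → ℂ, (∀ z ∈ ball (0:ℂ) 1, g (φ z) = z) ∧
    (∀ w ∈ φ '' ball (0:ℂ) 1, g w ∈ ball (0:ℂ) 1 ∧ φ (g w) = w ∧ ContinuousAt g w) := by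
  have hl := h.inj.leftInvOn_invFunOn
  refine ⟨Function.invFunOn φ (ball 0 1), fun z hz => hl hz, ?_⟩
  rintro w ⟨z, hz, rfl⟩
  rw [hl hz]
  refine ⟨hz, rfl, ?_⟩
  intro V hV
  rw [hl hz] at hV
  have ho := h.isOpen (s := interior V ∩ ball 0 1) inter_subset_right (isOpen_interior.inter isOpen_ball)
  have hm : φ z ∈ φ '' (interior V ∩ ball 0 1) := ⟨z, ⟨mem_interior_iff_mem_nhds.mpr hV, hz⟩, rfl⟩
  rw [Filter.mem_map]
  filter_upwards [ho.mem_nhds hm]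
  rintro _ ⟨y, hy, rfl⟩
  show Function.invFunOn φ (ball 0 1) (φ y) ∈ V
  rw [hl hy.2]
  exact interior_subset hy.1

theorem US.fill {φ : ℂ → ℂ} {m R : ℝ} (h : US φ m) (hR : 0 < R)
    (hs : sphere (0:ℂ) R ⊆ φ '' ball (0:ℂ) 1) : closedBall (0:ℂ) R ⊆ φ '' ball (0:ℂ) 1 := by
  intro a ha
  by_contra hna
  have haR : a ∈ ball (0:ℂ) R := by
    simp only [mem_closedBall_zero_iff] at ha
    rw [mem_ball_zero_iff]
    refine lt_of_le_of_ne ha fun he => hna (hs (by simpa using he))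
  obtain ⟨g, hg1, hg2⟩ := h.inv
  have hne : ∀ z ∈ ball (0:ℂ) 1, φ z - a ≠ 0 := fun z hz h0 => hna ⟨z, hz, sub_eq_zero.mp h0⟩
  obtain ⟨L, hL, -, hL1⟩ := exists_log one_pos (h.diff.sub_const a) hne (log (φ 0 - a))
    (Complex.exp_log (hne 0 (by simp)))
  have hΩ := h.isOpen subset_rfl isOpen_ball
  have hd : ∀ w ∈ sphere (0:ℂ) R, HasDerivWithinAt (fun w => L (g w)) ((w - a)⁻¹) (sphere 0 R) w := by
    intro w hw
    have hwΩ := hs hw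
    obtain ⟨h1, h2, h3⟩ := hg2 w hwΩ
    have hc : ContinuousAt (fun w => L (g w)) w :=
      ContinuousAt.comp (f := g) (g := L) (hL.continuousOn.continuousAt (isOpen_ball.mem_nhds h1)) h3
    have e1 : exp (L (g w)) = w - a := by rw [hL1 _ h1, h2]
    refine HasDerivAt.hasDerivWithinAt ?_
    refine HasDerivAt.of_local_left_inverse (f := fun x => exp x + a) hc ?_ ?_ ?_
    · simpa [e1] using ((Complex.hasDerivAt_exp (L (g w))).add_const a)
    · rw [← e1]; exact Complex.exp_ne_zero _
    · filter_upwards [hΩ.mem_nhds hwΩ] with y hy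
      obtain ⟨h1, h2, h3⟩ := hg2 y hy
      rw [hL1 _ h1, h2]; ring
  have h1 := circleIntegral.integral_eq_zero_of_hasDerivWithinAt hR.le hd
  rw [circleIntegral.integral_sub_inv_of_mem_ball haR] at h1
  simp [Real.pi_ne_zero] at h1

theorem US.omit {φ : ℂ → ℂ} {m R : ℝ} (h : US φ m) (hmR : m < R) (hR1 : R < 1) :
    ∃ a : ℂ, ‖a‖ = R ∧ ∀ z ∈ ball (0:ℂ) 1, φ z ≠ a := by
  by_contra hcon
  push Not at hcon
  have hR : 0 < R := h.pos.trans hmR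
  have hs : closedBall (0:ℂ) R ⊆ φ '' ball (0:ℂ) 1 := h.fill hR (fun a ha => by
    obtain ⟨z, hz, hz1⟩ := hcon a (by simpa using ha)
    exact ⟨z, hz, hz1⟩)
  obtain ⟨g, hg1, hg2⟩ := h.inv
  obtain ⟨d1, d2, d3, d4⟩ := h.dsl
  set K := g '' closedBall (0:ℂ) R with hK
  have hKc : IsCompact K := (isCompact_closedBall (0:ℂ) R).image_of_continuousOn
    (fun w hw => (hg2 w (hs hw)).2.2.continuousWithinAt)
  have hKb : K ⊆ ball 0 1 := by
    rintro _ ⟨w, hw, rfl⟩; exact (hg2 w (hs hw)).1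
  set V := ball (0:ℂ) 1 ∩ φ ⁻¹' (ball 0 R) with hV
  have hVo : IsOpen V := h.diff.continuousOn.isOpen_inter_preimage isOpen_ball isOpen_ball
  have hVK : V ⊆ K := by
    rintro z ⟨hz, hz2⟩
    exact ⟨φ z, ball_subset_closedBall hz2, hg1 z hz⟩
  have hcl : closure V ⊆ K := closure_minimal hVK hKc.isClosed
  have h0 : (0:ℂ) ∈ V := ⟨by simp, by simp [h.zero, hR]⟩
  have := Complex.norm_le_of_forall_mem_frontier_norm_le (U := V) (f := fun z => (dslope φ 0 z)⁻¹)
    (C := 1 / R) (hKc.isBounded.subset hVK) ?_ ?_ (subset_closure h0)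
  · rw [d2] at this
    simp only [norm_inv, Complex.norm_real, Real.norm_eq_abs, abs_of_pos h.pos] at this
    rw [one_div, inv_le_inv₀ h.pos hR] at this
    linarith
  · exact (d1.inv d4 |>.mono (hcl.trans hKb)).diffContOnCl
  · intro z hz
    have hzb : z ∈ ball (0:ℂ) 1 := hKb (hcl hz.1)
    have hφ : R ≤ ‖φ z‖ := by
      by_contra hlt
      push Not at hlt
      have : z ∈ V := ⟨hzb, by simpa using hlt⟩
      rw [hVo.frontier_eq] at hz
      exact hz.2 this
    have hz1 : ‖z‖ < 1 := by simpa using hzb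
    have e := d3 z
    rw [norm_inv, one_div]
    apply inv_anti₀ hR
    calc R ≤ ‖z * dslope φ 0 z‖ := by rw [e]; exact hφ
      _ ≤ 1 * ‖dslope φ 0 z‖ := by rw [norm_mul]; gcongr
      _ = _ := one_mul _

theorem mob_norm {β S : ℂ} (hβ : ‖β‖ < 1) (hS : ‖S‖ < 1) : ‖(β - S) / (1 - conj β * S)‖ < 1 ∧
    1 - conj β * S ≠ 0 := by
  have hne : 1 - conj β * S ≠ 0 := by
    intro h
    have h1 : conj β * S = 1 := by rw [sub_eq_zero] at h; exact h.symm
    have h2 := congrArg norm h1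
    rw [norm_mul, RCLike.norm_conj, norm_one] at h2
    nlinarith [norm_nonneg β, norm_nonneg S]
  refine ⟨?_, hne⟩
  rw [norm_div, div_lt_one (norm_pos_iff.mpr hne)]
  refine lt_of_pow_lt_pow_left₀ 2 (norm_nonneg _) ?_
  have e : ‖1 - conj β * S‖ ^ 2 - ‖β - S‖ ^ 2 = (1 - ‖β‖ ^ 2) * (1 - ‖S‖ ^ 2) := by
    simp only [← Complex.normSq_eq_norm_sq, Complex.normSq_apply]
    simp; ring
  have : 0 < (1 - ‖β‖ ^ 2) * (1 - ‖S‖ ^ 2) := by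
    apply mul_pos <;> nlinarith [norm_nonneg β, norm_nonneg S]
  linarith

end Bohr


namespace Bohr
open Complex Metric Set Filter Topology
open scoped ComplexConjugate

theorem koebe_alg {β S z φ B B1 : ℂ} (hR : 1 + B ≠ 0) (hB1 : β * B1 = B) (hz : z = (β - S) / (1 - B1 * S))
    (hd : 1 - B1 * S ≠ 0) (hφ : S ^ 2 * (1 - B1 ^ 2 * φ) = β ^ 2 - φ) :
    z * (2 * β / (1 + B) - z) = φ * (1 - 2 * B1 / (1 + B) * z) := by
  subst hB1
  have e : z * (1 - B1 * S) = β - S := by rw [hz, div_mul_cancel₀ _ hd]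
  have key : ((z * (2 * β - (1 + β * B1) * z)) - φ * ((1 + β * B1) - 2 * B1 * z)) * (1 - B1 * S) ^ 2 = 0 := by
    have e2 : ((z * (2 * β - (1 + β * B1) * z)) - φ * ((1 + β * B1) - 2 * B1 * z)) * (1 - B1 * S) ^ 2
      = (z * (1 - B1 * S)) * (2 * β * (1 - B1 * S) - (1 + β * B1) * (z * (1 - B1 * S)))
        - φ * ((1 + β * B1) * (1 - B1 * S) - 2 * B1 * (z * (1 - B1 * S))) * (1 - B1 * S) := by ring
    rw [e2, e]
    linear_combination (-(1 - β * B1)) * hφ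
  have k2 := (mul_eq_zero.mp key).resolve_right (pow_ne_zero 2 hd)
  field_simp
  linear_combination k2

theorem US.koebe {φ : ℂ → ℂ} {m R κ : ℝ} (h : US φ m) (hmR : m < R) (hR1 : R < 1)
    (hκ : κ = 2 * Real.sqrt R / (1 + R)) :
    ∃ φ1 p : ℂ → ℂ, US φ1 (m / κ) ∧ DifferentiableOn ℂ p (ball 0 κ) ∧
      (∀ z ∈ ball (0:ℂ) κ, 0 ≤ (p z).re) ∧ p 0 = ((-Real.log κ : ℝ) : ℂ) ∧
      ∀ z, ‖z‖ < κ → φ z = φ1 z * exp (-p (φ1 z)) := by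
  obtain ⟨a, haR, ha⟩ := h.omit hmR hR1
  have hR : 0 < R := h.pos.trans hmR
  have ha0 : a ≠ 0 := by rw [← norm_pos_iff, haR]; exact hR
  set b := Real.sqrt R with hb
  have hb0 : 0 < b := Real.sqrt_pos.mpr hR
  have hbR : b ^ 2 = R := Real.sq_sqrt hR.le
  have hb1 : b < 1 := by nlinarith
  have hκ0 : 0 < κ := by rw [hκ]; positivity
  have hκ1 : κ < 1 := by
    rw [hκ, div_lt_one (by linarith)]
    nlinarith [mul_pos (sub_pos.mpr hb1) (sub_pos.mpr hb1)]
  have hφ1 : ∀ z ∈ ball (0:ℂ) 1, ‖φ z‖ < 1 := fun z hz => by simpa using h.maps hz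
  have hT := fun z (hz : z ∈ ball (0:ℂ) 1) => mob_norm (β := a) (S := φ z) (by rw [haR]; exact hR1) (hφ1 z hz)
  obtain ⟨L, hL, hL0, hL1⟩ := exists_log (f := fun z => (a - φ z) / (1 - conj a * φ z)) one_pos
    (by
      refine DifferentiableOn.div (h.diff.const_sub _) ?_ (fun z hz => (hT z hz).2)
      exact (h.diff.const_mul _).const_sub _)
    (fun z hz => div_ne_zero (fun h0 => ha z hz (sub_eq_zero.mp h0).symm) (hT z hz).2)
    (log a) (by rw [Complex.exp_log ha0, h.zero]; simp)
  set S : ℂ → ℂ := fun z => exp (L z / 2) with hS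
  have hS2 : ∀ z ∈ ball (0:ℂ) 1, S z ^ 2 = (a - φ z) / (1 - conj a * φ z) := fun z hz => by
    rw [← hL1 z hz, hS, ← Complex.exp_nat_mul]; congr 1; push_cast; ring
  set β := S 0 with hβ
  have hβ2 : β ^ 2 = a := by
    rw [hβ, hS2 0 (by simp), h.zero]; simp
  have hβn : ‖β‖ = b := by
    have : ‖β‖ ^ 2 = b ^ 2 := by rw [← norm_pow, hβ2, haR, hbR]
    exact (pow_left_inj₀ (norm_nonneg _) hb0.le (by norm_num)).mp this
  have hSn : ∀ z ∈ ball (0:ℂ) 1, ‖S z‖ < 1 := fun z hz => by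
    have h1 := (hT z hz).1
    rw [← hS2 z hz, norm_pow] at h1
    nlinarith [norm_nonneg (S z)]
  have hSd : DifferentiableOn ℂ S (ball 0 1) := (hL.div_const 2).cexp
  have hZ := fun z (hz : z ∈ ball (0:ℂ) 1) => mob_norm (β := β) (S := S z) (by rw [hβn]; exact hb1) (hSn z hz)
  set ζ : ℂ → ℂ := fun z => (β - S z) / (1 - conj β * S z) with hζ
  have hζd : DifferentiableOn ℂ ζ (ball 0 1) := by
    refine DifferentiableOn.div (hSd.const_sub _) ?_ (fun z hz => (hZ z hz).2)
    exact (hSd.const_mul _).const_sub _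
  have hββ : β * conj β = (b : ℂ) ^ 2 := by
    rw [Complex.mul_conj, Complex.normSq_eq_norm_sq, hβn]; push_cast; rfl
  have hbc : (b : ℂ) ≠ 0 := by exact_mod_cast hb0.ne'
  have hRc : (1 + (b : ℂ) ^ 2) ≠ 0 := by
    have : (1 + b ^ 2) ≠ 0 := by positivity
    exact_mod_cast this
  have hβ0 : β ≠ 0 := by rw [← norm_pos_iff, hβn]; exact hb0
  set ν : ℂ := conj β / b with hν
  set ν1 : ℂ := β / b with hν1
  have hνν : ν * ν1 = 1 := by
    rw [hν, hν1, div_mul_div_comm, mul_comm, hββ]; field_simp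
  have hνn : ‖ν‖ = 1 := by
    rw [hν, norm_div, RCLike.norm_conj, hβn, Complex.norm_real, Real.norm_eq_abs, abs_of_pos hb0]
    field_simp
  have hν1n : ‖ν1‖ = 1 := by
    rw [hν1, norm_div, hβn, Complex.norm_real, Real.norm_eq_abs, abs_of_pos hb0]
    field_simp
  have hκc : (κ : ℂ) = 2 * b / (1 + (b : ℂ) ^ 2) := by rw [hκ, ← hbR]; push_cast; rfl
  set φ1 : ℂ → ℂ := fun z => ν1 * ζ z with hφ1
  have hζ0 : ζ 0 = 0 := by simp [hζ, ← hβ]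
  have hζn : ∀ z ∈ ball (0:ℂ) 1, ‖ζ z‖ < 1 := fun z hz => (hZ z hz).1
  have hφ1n : ∀ z ∈ ball (0:ℂ) 1, ‖φ1 z‖ < 1 := fun z hz => by
    rw [hφ1]; simp only [norm_mul, hν1n, one_mul]; exact hζn z hz
  have hφ1d : DifferentiableOn ℂ φ1 (ball 0 1) := hζd.const_mul _
  -- main identity
  have hid : ∀ z ∈ ball (0:ℂ) 1, φ1 z * (κ - ν ^ 2 * φ1 z) = φ z * (1 - κ * (ν ^ 2 * φ1 z)) := by
    intro z hz
    have h1 := koebe_alg (β := β) (S := S z) (z := ζ z) (φ := φ z) hRc hββ rfl (hZ z hz).2 (by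
      rw [hS2 z hz, hβ2, ← map_pow, hβ2]
      exact div_mul_cancel₀ _ (hT z hz).2)
    have e1 : φ1 z * (κ - ν ^ 2 * φ1 z) = ζ z * (2 * β / (1 + (b:ℂ) ^ 2) - ζ z) := by
      have : φ1 z * (κ - ν ^ 2 * φ1 z) = ζ z * (κ * ν1 - (ν * ν1) ^ 2 * ζ z) := by rw [hφ1]; ring
      rw [this, hνν, hκc, hν1]; field_simp
    have e2 : φ z * (1 - κ * (ν ^ 2 * φ1 z)) = φ z * (1 - 2 * conj β / (1 + (b:ℂ) ^ 2) * ζ z) := by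
      have : φ z * (1 - κ * (ν ^ 2 * φ1 z)) = φ z * (1 - κ * (ν * (ν * ν1)) * ζ z) := by rw [hφ1]; ring
      rw [this, hνν, hκc, hν]; field_simp
    rw [e1, e2, h1]
  have hUS : US φ1 (m / κ) := by
    refine ⟨hφ1d, ?_, fun z hz => by simpa using hφ1n z hz, by simp [hφ1, hζ0], ?_, div_pos h.pos hκ0⟩
    · intro z hz w hw hzw
      apply h.inj hz hw
      have h1 := hid z hz
      have h2 := hid w hw
      rw [hzw] at h1
      have hne : (1 - κ * (ν ^ 2 * φ1 w)) ≠ 0 := by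
        have := (mob_norm (β := κ) (S := ν ^ 2 * φ1 w) (by
          rw [Complex.norm_real, Real.norm_eq_abs, abs_of_pos hκ0]; exact hκ1) (by
          rw [norm_mul, norm_pow, hνn, one_pow, one_mul]; exact hφ1n w hw)).2
        rwa [Complex.conj_ofReal] at this
      exact mul_right_cancel₀ hne (h1.symm.trans h2)
    · have m0 : ball (0:ℂ) 1 ∈ 𝓝 (0:ℂ) := ball_mem_nhds 0 one_pos
      have d1 := (hφ1d.differentiableAt m0).hasDerivAt
      have d0 := (h.diff.differentiableAt m0).hasDerivAt
      have a1 := d1.mul ((d1.const_mul (ν ^ 2)).const_sub (κ : ℂ))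
      have a2 := d0.mul (((d1.const_mul (ν ^ 2)).const_mul (κ:ℂ)).const_sub 1)
      have a3 := (a2.congr_of_eventuallyEq (f₁ := φ1 * fun z => (κ - ν ^ 2 * φ1 z)) (by
        filter_upwards [m0] with z hz using hid z hz)).unique a1
      have z1 : φ1 0 = 0 := by simp [hφ1, hζ0]
      rw [h.der, h.zero, z1] at a3
      simp only [mul_zero, sub_zero, mul_one, zero_mul, add_zero] at a3
      have : (κ : ℂ) ≠ 0 := by exact_mod_cast hκ0.ne'
      push_cast
      rw [eq_div_iff this]
      exact a3.symm
  -- the logarithm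
  have hmob : ∀ z ∈ ball (0:ℂ) κ, ‖(κ - ν ^ 2 * z) / (1 - κ * (ν ^ 2 * z))‖ < 1 ∧
      (1 - κ * (ν ^ 2 * z)) ≠ 0 ∧ (κ - ν ^ 2 * z) ≠ 0 := fun z hz => by
    have hzκ : ‖z‖ < κ := by simpa using hz
    have hn : ‖ν ^ 2 * z‖ = ‖z‖ := by rw [norm_mul, norm_pow, hνn, one_pow, one_mul]
    have := mob_norm (β := κ) (S := ν ^ 2 * z) (by
          rw [Complex.norm_real, Real.norm_eq_abs, abs_of_pos hκ0]; exact hκ1) (by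
          rw [hn]; linarith)
    rw [Complex.conj_ofReal] at this
    refine ⟨this.1, this.2, fun h0 => ?_⟩
    rw [sub_eq_zero] at h0
    rw [← h0, Complex.norm_real, Real.norm_eq_abs, abs_of_pos hκ0] at hn
    linarith
  obtain ⟨P, hP, hP0, hP1⟩ := exists_log (f := fun z => (κ - ν ^ 2 * z) / (1 - κ * (ν ^ 2 * z))) hκ0
    (DifferentiableOn.div (by fun_prop) (by fun_prop) (fun z hz => (hmob z hz).2.1))
    (fun z hz => div_ne_zero (hmob z hz).2.2 (hmob z hz).2.1) ((Real.log κ : ℝ) : ℂ) (by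
      rw [← Complex.ofReal_exp, Real.exp_log hκ0]; simp)
  refine ⟨φ1, fun z => -P z, hUS, hP.neg, fun z hz => ?_, by simp [hP0], fun z hz => ?_⟩
  · have h1 := (hmob z hz).1
    rw [← hP1 z hz, Complex.norm_exp, Real.exp_lt_one_iff] at h1
    simp; exact h1.le
  · have hz1 : ‖z‖ < 1 := by linarith
    have hw : φ1 z ∈ ball (0:ℂ) κ := by
      have := hUS.schwarz hz1
      rw [mem_ball_zero_iff]; linarith
    rw [neg_neg, hP1 _ hw, ← mul_div_assoc, hid z (by simpa using hz1), mul_div_assoc,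
      div_self (hmob _ hw).2.1, mul_one]

end Bohr


namespace Bohr
open Complex Metric Set Filter Topology
open scoped ComplexConjugate

theorem log_unique {L1 L2 : ℂ → ℂ} {r : ℝ} (h1 : DifferentiableOn ℂ L1 (ball 0 r))
    (h2 : DifferentiableOn ℂ L2 (ball 0 r)) (h0 : L1 0 = L2 0)
    (he : ∀ z ∈ ball (0:ℂ) r, exp (L1 z) = exp (L2 z)) : ∀ z ∈ ball (0:ℂ) r, L1 z = L2 z := by
  intro z hz
  have hr : 0 < r := (norm_nonneg z).trans_lt (by simpa using hz)
  have hd : ∀ z ∈ ball (0:ℂ) r, HasDerivAt (fun z => L1 z - L2 z) 0 z := by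
    intro z hz
    have m0 := isOpen_ball.mem_nhds hz
    have a1 := (h1.differentiableAt m0).hasDerivAt
    have a2 := (h2.differentiableAt m0).hasDerivAt
    have b1 := a1.cexp
    have b2 := (a2.cexp.congr_of_eventuallyEq (f₁ := fun z => exp (L1 z)) (by
        filter_upwards [m0] with z hz using he z hz)).unique b1
    have b3 : deriv L1 z = deriv L2 z := by
      rw [he z hz] at b2
      exact (mul_left_cancel₀ (exp_ne_zero _) b2).symm
    have := a1.sub a2
    rw [b3, sub_self] at this
    exact this
  have h3 := (convex_ball (0:ℂ) r).is_const_of_fderivWithin_eq_zero (𝕜 := ℂ)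
    (f := fun z => L1 z - L2 z) (h1.sub h2) (fun x hx => by
      have := (hd x hx).hasFDerivAt.hasFDerivWithinAt (s := ball (0:ℂ) r)
      rw [this.fderivWithin (isOpen_ball.uniqueDiffWithinAt hx)]
      ext; simp) hz (show (0:ℂ) ∈ ball (0:ℂ) r by simpa using hr)
  simp only [h0, sub_self] at h3
  exact sub_eq_zero.mp h3

def OS (s r A C δ0 : ℝ) : Prop := ∀ (ρ ε δ κ : ℝ) (c d : ℕ → ℂ) (Q p q : ℂ → ℂ),
      0 ≤ ρ → ρ ≤ s ^ 2 → 0 ≤ ε → ε ≤ δ → δ ≤ δ0 → 1 - δ ≤ κ → PS c r Q →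
      (∀ k, ‖c k‖ * r ^ k ≤ A) → DifferentiableOn ℂ p (ball 0 κ) →
      (∀ z ∈ ball (0:ℂ) κ, 0 ≤ (p z).re) → p 0 = ε → PS d r q →
      (∀ z, ‖z‖ < r → q z = Q (z * exp (-p z)) - (p z - ε)) →
      D d ρ - 4 * ell ρ ≤ D c (ρ - ε * (1 - ρ) / (1 + ρ) * ρ) -
        4 * ell (ρ - ε * (1 - ρ) / (1 + ρ) * ρ) + C * (ε * δ)

theorem coef_bound {P : ℂ → ℂ} {κ e L r : ℝ} {c : ℕ → ℂ} (hP : DifferentiableOn ℂ P (ball 0 κ))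
    (hre : ∀ z ∈ ball (0:ℂ) κ, 0 ≤ (P z).re) (h0 : P 0 = (e : ℂ)) (he : 0 ≤ e) (heL : e ≤ L)
    (hr : 0 < r) (hr1 : r < 1) (hκ : (1 + r) / 2 ≤ κ) (hc : PS c r (fun z => (e : ℂ) - P z)) (k : ℕ) :
    ‖c k‖ * r ^ k ≤ L + 4 / (1 - (2 * r / (1 + r)) ^ 2) * L := by
  obtain ⟨c', hc'⟩ := exists_PS (f := fun z => (e : ℂ) - P z) (hP.const_sub _)
  have hrκ : r < κ := by linarith
  obtain rfl := hc.unique (hc'.mono hrκ.le) hr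
  have ht0 : 0 ≤ 2 * r / (1 + r) := by positivity
  have ht : 2 * r / (1 + r) < 1 := by rw [div_lt_one (by linarith)]; linarith
  have hB : 0 < 1 - (2 * r / (1 + r)) ^ 2 := by nlinarith
  refine hc'.cauchy hr.le hrκ (fun z hz => ?_) k
  have h1 := car_bound hP he hre h0 ht0 ht (by linarith) (z := z) (by
    rw [hz, div_mul_eq_mul_div, le_div_iff₀ (by linarith)]; nlinarith)
  calc ‖(e : ℂ) - P z‖ ≤ ‖(e:ℂ)‖ + ‖P z‖ := norm_sub_le _ _
    _ ≤ L + 4 / (1 - (2 * r / (1 + r)) ^ 2) * L := by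
      rw [Complex.norm_real, Real.norm_eq_abs, abs_of_nonneg he]
      refine add_le_add heL (h1.trans ?_)
      gcongr

def St (φ : ℂ → ℂ) (m κ ε ω C s r : ℝ) (n : ℕ) : Prop :=
  ∃ P ψ : ℂ → ℂ, US ψ (m / κ ^ n) ∧ DifferentiableOn ℂ P (ball 0 κ) ∧
    (∀ z ∈ ball (0:ℂ) κ, 0 ≤ (P z).re) ∧ P 0 = ((n * ε : ℝ) : ℂ) ∧
    (∀ z, ‖z‖ < κ → φ z = ψ z * exp (-P (ψ z))) ∧
    ∀ c, PS c r (fun z => ((n * ε : ℝ) : ℂ) - P z) → ∀ ρ, 0 ≤ ρ → ρ ≤ s ^ 2 →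
      D c ρ - 4 * ell ρ ≤ n * (C * (ε * ω))

theorem ell_nn {ρ : ℝ} (h : 0 ≤ ρ) (h1 : ρ < 1) : 0 ≤ ell ρ := by
  unfold ell
  have := Real.log_nonpos (x := 1 - ρ) (by linarith) (by linarith)
  linarith

theorem St_zero {φ : ℂ → ℂ} {m κ ε ω C s r : ℝ} (h : US φ m) (hr : 0 < r) (hs : 0 ≤ s) (hs1 : s < 1) :
    St φ m κ ε ω C s r 0 := by
  refine ⟨fun _ => 0, φ, by simpa using h, by fun_prop, by simp, by simp, by simp, ?_⟩
  intro c hc ρ hρ hρs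
  have hc0 := hc.unique ((PS_const 0 r).congr (fun z _ => by simp)) hr
  have hD : D c ρ = 0 := by
    unfold D; rw [hc0]; simp
  have := ell_nn hρ (by nlinarith)
  rw [hD]; simp; exact this

theorem shrink {z p : ℂ} (h : 0 ≤ p.re) : ‖z * exp (-p)‖ ≤ ‖z‖ := by
  rw [norm_mul, Complex.norm_exp]
  have : Real.exp (-p).re ≤ 1 := by rw [Real.exp_le_one_iff]; simpa using h
  exact mul_le_of_le_one_right (norm_nonneg _) this

theorem neps {m κ : ℝ} (hm : 0 < m) (hκ : 0 < κ) {n : ℕ} (h : m / κ ^ n ≤ 1) :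
    n * (-Real.log κ) ≤ - Real.log m := by
  rw [div_le_one (by positivity)] at h
  have := Real.log_le_log hm h
  rw [Real.log_pow] at this
  linarith

theorem St_step {φ : ℂ → ℂ} {m R κ ε ω C s r δ0 : ℝ} {n : ℕ}
    (hOS : OS s r (-Real.log m + 4 / (1 - (2 * r / (1 + r)) ^ 2) * (-Real.log m)) C δ0)
    (hm : 0 < m) (hs1 : s < 1) (hr : 0 < r) (hr1 : r < 1) (hR1 : R < 1)
    (hκR : κ = 2 * Real.sqrt R / (1 + R)) (hκ : (1 + r) / 2 ≤ κ) (hε : ε = - Real.log κ)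
    (hε0 : 0 ≤ ε) (hεω : ε ≤ ω) (hω1 : ω ≤ 1) (hωδ : ω ≤ δ0) (hωκ : 1 - ω ≤ κ)
    (hs : 0 ≤ s) (hmR : m / κ ^ n < R)
    (h : St φ m κ ε ω C s r n) : St φ m κ ε ω C s r (n + 1) := by
  obtain ⟨P, ψ, hψ, hP, hPre, hP0, hφ, hD⟩ := h
  obtain ⟨ψ1, p, hψ1, hp, hpre, hp0, hid⟩ := hψ.koebe hmR hR1 hκR
  have hκ0 : 0 < κ := by linarith
  have hmap : MapsTo (fun z => z * exp (-p z)) (ball 0 κ) (ball 0 κ) := fun z hz => by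
    have h1 := shrink (z := z) (hpre z hz)
    simp only [mem_ball_zero_iff] at hz ⊢
    linarith
  have hnε : n * ε ≤ - Real.log m := by rw [hε]; exact neps hm hκ0 hψ.le_one
  rw [← hε] at hp0
  have hdP : DifferentiableOn ℂ (fun z => P (z * exp (-p z))) (ball 0 κ) :=
    hP.comp (differentiableOn_id.mul hp.neg.cexp) hmap
  refine ⟨fun z => p z + P (z * exp (-p z)), ψ1, ?_, hp.add hdP, ?_, ?_, ?_, ?_⟩
  · rw [pow_succ, ← div_div]; exact hψ1
  · intro z hz
    rw [Complex.add_re]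
    exact add_nonneg (hpre z hz) (hPre _ (hmap hz))
  · show p 0 + P (0 * exp (-p 0)) = _
    rw [zero_mul, hp0, hP0]; push_cast; ring
  · intro z hz
    have hz1 : ‖z‖ < 1 := by
      have := hψ1.pos
      have h3 : κ ≤ 1 := by
        have := Real.log_nonpos_iff hκ0.le |>.mp (by linarith : Real.log κ ≤ 0)
        exact this
      linarith
    rw [hφ z hz, hid z hz, mul_assoc, ← Complex.exp_add]
    congr 2; ring
  · intro c hc ρ hρ hρs
    obtain ⟨c0, hc0⟩ := exists_PS (f := fun z => ((n * ε : ℝ) : ℂ) - P z) (hP.const_sub _)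
    have hrκ : r ≤ κ := by linarith
    replace hc0 := hc0.mono hrκ
    have h1 := hOS ρ ε ω κ c0 c _ p _ hρ hρs hε0 hεω hωδ hωκ hc0
      (fun k => coef_bound hP hPre hP0 (by positivity) hnε hr hr1 hκ hc0 k) hp hpre hp0 hc (by
        intro z hz
        push_cast; ring)
    have hρ1 : ρ < 1 := by nlinarith
    have hη : 0 ≤ ε * (1 - ρ) / (1 + ρ) := div_nonneg (mul_nonneg hε0 (by linarith)) (by linarith)
    have hη1 : ε * (1 - ρ) / (1 + ρ) ≤ 1 := by
      rw [div_le_one (by linarith)]; nlinarith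
    have h2 := hD c0 hc0 (ρ - ε * (1 - ρ) / (1 + ρ) * ρ) (by nlinarith) (by nlinarith)
    push_cast
    linarith

theorem St_last {φ q : ℂ → ℂ} {m R κ ε ω C s r δ0 : ℝ} {n : ℕ} {d : ℕ → ℂ} {ρ : ℝ}
    (hOS : OS s r (-Real.log m + 4 / (1 - (2 * r / (1 + r)) ^ 2) * (-Real.log m)) C δ0)
    (hm : 0 < m) (hs1 : s < 1) (hr : 0 < r) (hr1 : r < 1) (hR : R = Real.exp (-ω))
    (hκ : (1 + r) / 2 ≤ κ) (hκ1 : κ ≤ 1) (hε : ε = - Real.log κ)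
    (hω0 : 0 ≤ ω) (hω1 : ω ≤ 1) (hωδ : ω ≤ δ0)
    (hmR : R ≤ m / κ ^ n)
    (hq : DifferentiableOn ℂ q (ball 0 1)) (hq0 : q 0 = 0)
    (hφq : ∀ z ∈ ball (0:ℂ) 1, φ z = m * z * exp (q z)) (hd : PS d 1 q)
    (hρ : 0 ≤ ρ) (hρs : ρ ≤ s ^ 2) (hs : 0 ≤ s)
    (h : St φ m κ ε ω C s r n) : D d ρ - 4 * ell ρ ≤ C * (-Real.log m) * ω := by
  obtain ⟨P, ψ, hψ, hP, hPre, hP0, hφ, hD⟩ := h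
  have hκ0 : 0 < κ := by linarith
  have hnε : n * ε ≤ - Real.log m := by rw [hε]; exact neps hm hκ0 hψ.le_one
  have hε0 : 0 ≤ ε := by rw [hε]; have := Real.log_nonpos hκ0.le hκ1; linarith
  obtain ⟨s1, s2, s3, s4⟩ := hψ.dsl
  set mk := m / κ ^ n with hmk
  have hmk0 : 0 < mk := hψ.pos
  have hmkl : Real.log mk = Real.log m + n * ε := by
    rw [hmk, Real.log_div hm.ne' (by positivity), Real.log_pow, hε]; ring
  obtain ⟨L, hL, hL0, hL1⟩ := exists_log one_pos s1 s4 ((Real.log mk : ℝ) : ℂ) (by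
    rw [← Complex.ofReal_exp, Real.exp_log hmk0, s2])
  have hLre : ∀ z ∈ ball (0:ℂ) 1, (L z).re ≤ 0 := by
    intro z hz
    have hz1 : ‖z‖ < 1 := by simpa using hz
    have : ‖dslope ψ 0 z‖ ≤ 1 := by
      by_cases hz0 : z = 0
      · rw [hz0, s2, Complex.norm_real, Real.norm_eq_abs, abs_of_pos hmk0]; exact hψ.le_one
      · have h1 := hψ.schwarz hz1
        rw [← s3 z, norm_mul] at h1
        have : 0 < ‖z‖ := norm_pos_iff.mpr hz0
        by_contra h2
        push Not at h2
        nlinarith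
    rw [← hL1 z hz, Complex.norm_exp] at this
    exact Real.exp_le_one_iff.mp this
  obtain ⟨c0, hc0⟩ := exists_PS (f := fun z => ((n * ε : ℝ) : ℂ) - P z) (hP.const_sub _)
  have hrκ : r ≤ κ := by linarith
  replace hc0 := hc0.mono hrκ
  have hsub : ball (0:ℂ) κ ⊆ ball 0 1 := ball_subset_ball hκ1
  have hψmap : MapsTo ψ (ball 0 κ) (ball 0 κ) := fun z hz => by
    simp only [mem_ball_zero_iff] at hz ⊢
    exact (hψ.schwarz (by linarith)).trans_lt hz
  have hψz : ∀ z ∈ ball (0:ℂ) 1, z * exp (L z) = ψ z := fun z hz => by rw [hL1 z hz, s3]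
  have hun := log_unique (r := κ) (L1 := fun z => L z - P (ψ z)) (L2 := fun z => q z + ((Real.log m : ℝ) : ℂ))
    ((hL.mono hsub).sub (hP.comp (hψ.diff.mono hsub) hψmap)) ((hq.mono hsub).add_const _)
    (by
      simp only [hL0, hψ.zero, hP0, hq0, hmkl]; push_cast; ring)
    (by
      intro z hz
      by_cases hz0 : z = 0
      · subst hz0
        congr 1
        simp only [hL0, hψ.zero, hP0, hq0, hmkl]; push_cast; ring
      · have h1 := hφ z (by simpa using hz)
        rw [hφq z (hsub hz)] at h1
        rw [sub_eq_add_neg, Complex.exp_add, Complex.exp_add, ← Complex.ofReal_exp, Real.exp_log hm]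
        apply mul_left_cancel₀ hz0
        rw [← mul_assoc, hψz z (hsub hz), ← h1]; ring)
  have hεl : -Real.log mk ≤ ω := by
    have := Real.log_le_log (by rw [hR]; exact Real.exp_pos _) hmR
    rw [hR, Real.log_exp] at this
    linarith
  have hεl0 : 0 ≤ -Real.log mk := by
    have := Real.log_nonpos hmk0.le hψ.le_one; linarith
  have h1 := hOS ρ (-Real.log mk) ω 1 c0 d _ (fun z => - L z) q hρ hρs hεl0 hεl hωδ (by linarith) hc0
      (fun k => coef_bound hP hPre hP0 (by positivity) hnε hr hr1 hκ hc0 k) hL.neg (by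
        intro z hz; have := hLre z hz; simpa using this) (by simp [hL0]) (hd.mono hr1.le) (by
        intro z hz
        have hz1 : z ∈ ball (0:ℂ) κ := by rw [mem_ball_zero_iff]; linarith
        have := hun z hz1
        simp only [neg_neg]
        rw [hψz z (hsub hz1), hmkl]
        push_cast
        linear_combination -this)
  have hρ1 : ρ < 1 := by nlinarith
  set e := -Real.log mk with he
  have hη : 0 ≤ e * (1 - ρ) / (1 + ρ) := div_nonneg (mul_nonneg hεl0 (by linarith)) (by linarith)
  have hη1 : e * (1 - ρ) / (1 + ρ) ≤ 1 := by
    rw [div_le_one (by linarith)]; nlinarith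
  have h2 := hD c0 hc0 (ρ - e * (1 - ρ) / (1 + ρ) * ρ) (by nlinarith) (by nlinarith)
  have h3 : -Real.log m = e + n * ε := by rw [he, hmkl]; ring
  rw [h3]
  linarith

theorem main_US {φ q : ℂ → ℂ} {m : ℝ} {d : ℕ → ℂ} {ρ : ℝ} (hφ : US φ m)
    (hq : DifferentiableOn ℂ q (ball 0 1)) (hq0 : q 0 = 0)
    (hφq : ∀ z ∈ ball (0:ℂ) 1, φ z = m * z * exp (q z)) (hd : PS d 1 q)
    (hρ : 0 ≤ ρ) (hρ1 : ρ < 1) : D d ρ ≤ 4 * ell ρ := by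
  set s := Real.sqrt ρ with hs
  have hs0 : 0 ≤ s := Real.sqrt_nonneg _
  have hs2 : s ^ 2 = ρ := Real.sq_sqrt hρ
  have hs1 : s < 1 := by nlinarith
  set r := (1 + s) / 2 with hr
  have hr0 : 0 < r := by positivity
  have hr1 : r < 1 := by rw [hr]; linarith
  have hsr : s < r := by rw [hr]; linarith
  have hm := hφ.pos
  have hL : 0 ≤ -Real.log m := by
    have := Real.log_nonpos hm.le hφ.le_one; linarith
  obtain ⟨C, δ0, hC, hδ0, hOS⟩ := onestep (A := -Real.log m + 4 / (1 - (2 * r / (1 + r)) ^ 2) * (-Real.log m))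
    hs0 hsr hr1 (by
      have ht0 : 0 ≤ 2 * r / (1 + r) := by positivity
      have ht : 2 * r / (1 + r) < 1 := by rw [div_lt_one (by linarith)]; linarith
      have hB : 0 < 1 - (2 * r / (1 + r)) ^ 2 := by nlinarith
      positivity)
  have key : ∀ ω : ℝ, 0 < ω → ω ≤ δ0 → ω ≤ (1 - r) / 2 → D d ρ - 4 * ell ρ ≤ C * (-Real.log m) * ω := by
    intro ω hω0 hωδ hωr
    set R := Real.exp (-ω) with hR
    have hR0 : 0 < R := Real.exp_pos _
    have hR1 : R < 1 := by rw [hR, Real.exp_lt_one_iff]; linarith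
    have hRω : 1 - ω ≤ R := by have := Real.add_one_le_exp (-ω); linarith
    obtain ⟨κ, hκR⟩ : ∃ κ, κ = 2 * Real.sqrt R / (1 + R) := ⟨_, rfl⟩
    have hsR : Real.sqrt R ^ 2 = R := Real.sq_sqrt hR0.le
    have hsR0 : 0 < Real.sqrt R := Real.sqrt_pos.mpr hR0
    have hsR1 : Real.sqrt R < 1 := by nlinarith
    have hRκ : R ≤ κ := by
      rw [hκR, le_div_iff₀ (by linarith)]; nlinarith
    have hκ0 : 0 < κ := by linarith
    have hκ1 : κ < 1 := by
      rw [hκR, div_lt_one (by linarith)]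
      nlinarith [mul_pos (sub_pos.mpr hsR1) (sub_pos.mpr hsR1)]
    obtain ⟨ε, hε⟩ : ∃ ε, ε = - Real.log κ := ⟨_, rfl⟩
    have hε0 : 0 < ε := by rw [hε]; have := Real.log_neg hκ0 hκ1; linarith
    have hεω : ε ≤ ω := by
      have := Real.log_le_log hR0 hRκ
      rw [hR, Real.log_exp] at this
      linarith
    have hω1 : ω ≤ 1 := by linarith
    have hκr : (1 + r) / 2 ≤ κ := by linarith
    by_contra hcon
    have hall : ∀ n : ℕ, St φ m κ ε ω C s r n := by
      intro n
      induction n with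
      | zero => exact St_zero hφ hr0 hs0 hs1
      | succ n ih =>
        refine St_step hOS hm hs1 hr0 hr1 hR1 hκR hκr hε hε0.le hεω hω1 hωδ (by linarith) hs0 ?_ ih
        by_contra h2
        push Not at h2
        exact hcon (St_last hOS hm hs1 hr0 hr1 hR hκr hκ1.le hε hω0.le hω1 hωδ h2 hq hq0 hφq hd hρ
          hs2.ge hs0 ih)
    obtain ⟨n, hn⟩ := exists_nat_gt (-Real.log m / ε)
    obtain ⟨P, ψ, hψ, -⟩ := hall n
    have := neps hm hκ0 hψ.le_one
    rw [← hε] at this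
    rw [div_lt_iff₀ hε0] at hn
    linarith
  by_contra hcon
  push Not at hcon
  set x := D d ρ - 4 * ell ρ with hx
  have hx0 : 0 < x := by rw [hx]; linarith
  set K := C * (-Real.log m) with hK
  have hK0 : 0 ≤ K := by positivity
  have h1 := key (min (min δ0 ((1 - r) / 2)) (x / (2 * (K + 1)))) (by
    refine lt_min (lt_min hδ0 (by linarith)) (by positivity))
    ((min_le_left _ _).trans (min_le_left _ _)) ((min_le_left _ _).trans (min_le_right _ _))
  have h2 : K * (min (min δ0 ((1 - r) / 2)) (x / (2 * (K + 1)))) ≤ K * (x / (2 * (K + 1))) :=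
    mul_le_mul_of_nonneg_left (min_le_right _ _) hK0
  have h3 : K * (x / (2 * (K + 1))) < x := by
    rw [← mul_div_assoc, div_lt_iff₀ (by linarith)]; nlinarith
  linarith

end Bohr


namespace Bohr
open Complex Metric Set Filter Topology
open scoped ComplexConjugate

theorem exp_rec {c a : ℕ → ℂ} {G F : ℂ → ℂ} (hG : PS c 1 G) (hF : PS a 1 F)
    (he : ∀ z ∈ ball (0:ℂ) 1, exp (G z) = F z) (n : ℕ) :
    ((n + 1 : ℕ) : ℂ) * a (n + 1) =
      ∑ p ∈ Finset.HasAntidiagonal.antidiagonal n, (((p.1 + 1 : ℕ) : ℂ) * c (p.1 + 1)) * a p.2 := by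
  have h1 := hF.zderiv
  have h2 := hG.zderiv.mul hF
  have h3 : PS _ 1 (fun z => z * deriv F z) := h2.congr (fun z hz => by
    have hz1 : z ∈ ball (0:ℂ) 1 := by simpa using hz
    have m0 := isOpen_ball.mem_nhds hz1
    have a1 := (hG.diff.differentiableAt m0).hasDerivAt.cexp
    have a2 := a1.congr_of_eventuallyEq (f₁ := F) (by
      filter_upwards [m0] with w hw using (he w hw).symm)
    rw [a2.deriv, he z hz1]; ring)
  have h4 := congrFun (h1.unique h3 one_pos) (n + 1)
  rw [h4, Finset.Nat.sum_antidiagonal_succ]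
  simp

theorem lm {γ a : ℕ → ℂ} {Γ F : ℂ → ℂ} (hΓ : PS γ 1 Γ) (hF : PS a 1 F) (hΓ0 : Γ 0 = 0)
    (he : ∀ z ∈ ball (0:ℂ) 1, exp (Γ z) = F z)
    (hs : ∀ ρ : ℝ, 0 ≤ ρ → ρ < 1 → Summable (fun k : ℕ => (k : ℝ) * ‖γ k‖ ^ 2 * ρ ^ k))
    {ρ : ℝ} (hρ : 0 ≤ ρ) (hρ1 : ρ < 1) :
    Summable (fun k => ‖a k‖ ^ 2 * ρ ^ k) ∧ ∑' k, ‖a k‖ ^ 2 * ρ ^ k ≤ Real.exp (D γ ρ) := by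
  set G : ℂ → ℂ := fun z => ∑' k : ℕ, (((k : ℝ) * ‖γ k‖ ^ 2 : ℝ) : ℂ) * z ^ k with hG
  have hGs : PS (fun k => (((k : ℝ) * ‖γ k‖ ^ 2 : ℝ) : ℂ)) 1 G := fun z hz => by
    apply Summable.hasSum
    apply Summable.of_norm
    refine (hs ‖z‖ (norm_nonneg _) hz).congr fun k => ?_
    rw [norm_mul, norm_pow, Complex.norm_real, Real.norm_eq_abs, abs_of_nonneg (by positivity)]
  have hG0 : G 0 = 0 := by rw [hGs.zero_val one_pos]; simp
  obtain ⟨e, hE⟩ := exists_PS (f := fun z => exp (G z)) hGs.diff.cexp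
  have e0 : e 0 = 1 := by rw [← hE.zero_val one_pos, hG0]; simp
  have a0 : a 0 = 1 := by rw [← hF.zero_val one_pos, ← he 0 (by simp), hΓ0]; simp
  have hrecE := exp_rec hGs hE (fun z _ => rfl)
  have hrecF := exp_rec hΓ hF he
  have main : ∀ k : ℕ, ‖a k‖ ^ 2 ≤ (e k).re ∧ (e k).im = 0 := by
    intro k
    induction k using Nat.strong_induction_on with
    | _ k ih =>
    rcases k with _ | n
    · rw [a0, e0]; simp
    · have hlt : ∀ p ∈ Finset.HasAntidiagonal.antidiagonal n, p.2 < n + 1 := fun p hp => by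
        have := Finset.HasAntidiagonal.mem_antidiagonal.mp hp; omega
      have hEr : ((n + 1 : ℕ) : ℝ) * (e (n + 1)).re = ∑ p ∈ Finset.HasAntidiagonal.antidiagonal n,
          ((p.1 + 1 : ℕ) : ℝ) * (((p.1 + 1 : ℕ) : ℝ) * ‖γ (p.1 + 1)‖ ^ 2) * (e p.2).re := by
        have := congrArg Complex.re (hrecE n)
        rw [Complex.re_sum, ← Complex.ofReal_natCast, Complex.re_ofReal_mul] at this
        rw [this]
        refine Finset.sum_congr rfl fun p hp => ?_
        rw [← Complex.ofReal_natCast, ← Complex.ofReal_mul, Complex.re_ofReal_mul]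
      have hEi : ((n + 1 : ℕ) : ℝ) * (e (n + 1)).im = 0 := by
        have := congrArg Complex.im (hrecE n)
        rw [Complex.im_sum, ← Complex.ofReal_natCast, Complex.im_ofReal_mul] at this
        rw [this]
        refine Finset.sum_eq_zero fun p hp => ?_
        rw [← Complex.ofReal_natCast, ← Complex.ofReal_mul, Complex.im_ofReal_mul,
          (ih p.2 (hlt p hp)).2, mul_zero]
      have hn : (0:ℝ) < ((n + 1 : ℕ) : ℝ) := by positivity
      refine ⟨?_, (mul_eq_zero.mp hEi).resolve_left hn.ne'⟩
      have h1 : ((n + 1 : ℕ) : ℝ) * ‖a (n + 1)‖ ≤ ∑ p ∈ Finset.HasAntidiagonal.antidiagonal n,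
          ((p.1 + 1 : ℕ) : ℝ) * ‖γ (p.1 + 1)‖ * ‖a p.2‖ := by
        have := congrArg norm (hrecF n)
        rw [norm_mul, Complex.norm_natCast] at this
        rw [this]
        refine (norm_sum_le _ _).trans_eq (Finset.sum_congr rfl fun p hp => ?_)
        rw [norm_mul, norm_mul, Complex.norm_natCast]
      have h2 := sq_sum_le_card_mul_sum_sq (s := Finset.HasAntidiagonal.antidiagonal n)
        (f := fun p => ((p.1 + 1 : ℕ) : ℝ) * ‖γ (p.1 + 1)‖ * ‖a p.2‖)
      rw [Finset.Nat.card_antidiagonal] at h2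
      have h3 : ∑ p ∈ Finset.HasAntidiagonal.antidiagonal n,
          (((p.1 + 1 : ℕ) : ℝ) * ‖γ (p.1 + 1)‖ * ‖a p.2‖) ^ 2 ≤ ((n + 1 : ℕ) : ℝ) * (e (n + 1)).re := by
        rw [hEr]
        refine Finset.sum_le_sum fun p hp => ?_
        have := (ih p.2 (hlt p hp)).1
        calc _ = ((p.1 + 1 : ℕ) : ℝ) * (((p.1 + 1 : ℕ) : ℝ) * ‖γ (p.1 + 1)‖ ^ 2) * ‖a p.2‖ ^ 2 := by ring
          _ ≤ _ := by gcongr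
      have h4 : (((n + 1 : ℕ) : ℝ) * ‖a (n + 1)‖) ^ 2 ≤ ((n + 1 : ℕ) : ℝ) * (((n + 1 : ℕ) : ℝ) * (e (n + 1)).re) := by
        refine (pow_le_pow_left₀ (by positivity) h1 2).trans (h2.trans ?_)
        gcongr
      have h5 : ((n + 1 : ℕ) : ℝ) ^ 2 * ‖a (n + 1)‖ ^ 2 ≤ ((n + 1 : ℕ) : ℝ) ^ 2 * (e (n + 1)).re := by
        nlinarith
      exact le_of_mul_le_mul_left h5 (by positivity)
  have hEρ := hE (ρ : ℂ) (by rw [Complex.norm_real, Real.norm_eq_abs, abs_of_nonneg hρ]; exact hρ1)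
  have hGρ : G ρ = ((D γ ρ : ℝ) : ℂ) := by
    unfold D
    rw [Complex.ofReal_tsum]
    exact tsum_congr fun k => by push_cast; ring
  have hre := Complex.hasSum_re hEρ
  simp only [hGρ] at hre
  rw [← Complex.ofReal_exp, Complex.ofReal_re] at hre
  have hre2 : HasSum (fun k => (e k).re * ρ ^ k) (Real.exp (D γ ρ)) := by
    convert hre using 2 with k
    rw [← Complex.ofReal_pow, Complex.re_mul_ofReal]
  have hle : ∀ k, ‖a k‖ ^ 2 * ρ ^ k ≤ (e k).re * ρ ^ k := fun k =>
    mul_le_mul_of_nonneg_right (main k).1 (by positivity)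
  have hsum := Summable.of_nonneg_of_le (fun k => by positivity) hle hre2.summable
  exact ⟨hsum, (hsum.tsum_le_tsum hle hre2.summable).trans_eq hre2.tsum_eq⟩

theorem D_s1 {c : ℕ → ℂ} {f : ℂ → ℂ} (h : PS c 1 f) {ρ : ℝ} (hρ : 0 ≤ ρ) (hρ1 : ρ < 1) :
    Summable (fun k : ℕ => (k : ℝ) * ‖c k‖ ^ 2 * ρ ^ k) := by
  set s := Real.sqrt ρ with hs
  have hs0 : 0 ≤ s := Real.sqrt_nonneg _
  have hs2 : s ^ 2 = ρ := Real.sq_sqrt hρ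
  have hs1 : s < 1 := by nlinarith
  obtain ⟨t, ht, ht1⟩ := exists_between hs1
  have ht0 : 0 < t := by linarith
  obtain ⟨A, hA0, hA⟩ := cpt_bound (h.contOn ht1)
  exact D_s ht0 (h.cauchy ht0.le ht1 hA) hρ (by nlinarith)

theorem odd_F {f : ℂ → ℂ} {a : ℕ → ℂ}
    (hf : ∀ z ∈ ball (0 : ℂ) 1, HasSum (fun k : ℕ => a k * z ^ (2 * k + 1)) (f z)) :
    ∃ F : ℂ → ℂ, PS a 1 F ∧ ∀ z ∈ ball (0:ℂ) 1, f z = z * F (z ^ 2) := by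
  have h1 : PS a 1 (fun z => ∑' k : ℕ, a k * z ^ k) := fun ζ hζ => by
    apply Summable.hasSum
    by_cases h0 : ζ = 0
    · exact summable_of_ne_finset_zero (s := {0}) (fun k hk => by
        have : k ≠ 0 := by simpa using hk
        simp [h0, this])
    obtain ⟨z, hz⟩ := IsAlgClosed.exists_pow_nat_eq ζ (n := 2) (by norm_num)
    have hz0 : z ≠ 0 := by rintro rfl; exact h0 (by rw [← hz]; simp)
    have hz1 : ‖z‖ < 1 := by
      rw [← hz, norm_pow] at hζ
      nlinarith [norm_nonneg z]
    have := (hf z (by simpa using hz1)).summable.mul_left z⁻¹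
    refine this.congr fun k => ?_
    rw [← hz, pow_succ, pow_mul]; field_simp
  refine ⟨_, h1, fun z hz => ?_⟩
  have hz1 : ‖z ^ 2‖ < 1 := by
    rw [norm_pow]
    have : ‖z‖ < 1 := by simpa using hz
    nlinarith [norm_nonneg z]
  refine (hf z hz).unique (hs_congr ((h1 (z ^ 2) hz1).mul_left z) fun k => ?_)
  rw [pow_succ, pow_mul]; ring

theorem milin {f F : ℂ → ℂ} {a : ℕ → ℂ} (hF : PS a 1 F) (ha1 : a 0 = 1)
    (hfF : ∀ z ∈ ball (0:ℂ) 1, f z = z * F (z ^ 2)) (hinj : InjOn f (ball 0 1)) :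
    ∃ (Γ : ℂ → ℂ) (γ : ℕ → ℂ), PS γ 1 Γ ∧ Γ 0 = 0 ∧ (∀ z ∈ ball (0:ℂ) 1, exp (Γ z) = F z) ∧
      ∀ ρ : ℝ, 0 ≤ ρ → ρ < 1 → D γ ρ ≤ ell ρ := by
  have hF0 : F 0 = 1 := by rw [hF.zero_val one_pos, ha1]
  have hsq : ∀ ζ ∈ ball (0:ℂ) 1, ∃ z ∈ ball (0:ℂ) 1, z ^ 2 = ζ := fun ζ hζ => by
    obtain ⟨z, hz⟩ := IsAlgClosed.exists_pow_nat_eq ζ (n := 2) (by norm_num)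
    refine ⟨z, ?_, hz⟩
    rw [mem_ball_zero_iff] at hζ ⊢
    rw [← hz, norm_pow] at hζ
    nlinarith [norm_nonneg z]
  have hf0 : f 0 = 0 := by rw [hfF 0 (by simp), zero_mul]
  have hFne : ∀ ζ ∈ ball (0:ℂ) 1, F ζ ≠ 0 := by
    intro ζ hζ h0
    obtain ⟨z, hz, rfl⟩ := hsq ζ hζ
    have h1 := hfF z hz
    rw [h0, mul_zero, ← hf0] at h1
    have := hinj hz (by simp) h1
    rw [this] at h0
    simp [hF0] at h0
  obtain ⟨Γ, hΓd, hΓ0, hΓ⟩ := exists_log one_pos hF.diff hFne 0 (by simp [hF0])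
  obtain ⟨γ, hγ⟩ := exists_PS hΓd
  refine ⟨Γ, γ, hγ, hΓ0, hΓ, ?_⟩
  have hinjh : InjOn (fun ζ => ζ * F ζ ^ 2) (ball 0 1) := by
    intro x hx y hy hxy
    obtain ⟨z, hz, rfl⟩ := hsq x hx
    obtain ⟨w, hw, rfl⟩ := hsq y hy
    have h1 : f z ^ 2 = f w ^ 2 := by
      rw [hfF z hz, hfF w hw, mul_pow, mul_pow]; exact hxy
    rcases sq_eq_sq_iff_eq_or_eq_neg.mp h1 with h2 | h2
    · rw [hinj hz hw h2]
    · have hw' : -w ∈ ball (0:ℂ) 1 := by simpa using hw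
      have : f (-w) = - f w := by rw [hfF w hw, hfF _ hw']; simp
      rw [← this] at h2
      rw [hinj hz hw' h2]; simp
  have key : ∀ t : ℝ, 0 < t → t < 1 → ∀ ρ : ℝ, 0 ≤ ρ → ρ < 1 → D γ (t ^ 2 * ρ) ≤ ell ρ := by
    intro t ht0 ht1 ρ hρ hρ1
    have hhd : DifferentiableOn ℂ (fun ζ => ζ * F ζ ^ 2) (ball 0 1) :=
      differentiableOn_id.mul (hF.diff.pow 2)
    obtain ⟨M0, hM0⟩ := (isCompact_closedBall (0:ℂ) t).exists_bound_of_continuousOn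
      (hhd.continuousOn.mono (closedBall_subset_ball ht1))
    set N := |M0| + 1 with hN
    have hN0 : 0 < N := by positivity
    have hM1 : M0 < N := by have := le_abs_self M0; linarith
    have htz : ∀ z ∈ ball (0:ℂ) 1, ‖(t:ℂ) * z‖ < t := fun z hz => by
      rw [norm_mul, Complex.norm_real, Real.norm_eq_abs, abs_of_pos ht0]
      have : ‖z‖ < 1 := by simpa using hz
      nlinarith
    have htm : MapsTo (fun z => (t:ℂ) * z) (ball 0 1) (ball 0 1) := fun z hz => by
      have := htz z hz
      rw [mem_ball_zero_iff]; linarith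
    have htc : (t : ℂ) ≠ 0 := by exact_mod_cast ht0.ne'
    have hNc : (N : ℂ) ≠ 0 := by exact_mod_cast hN0.ne'
    have hUS : US (fun z => (t * z) * F (t * z) ^ 2 / N) (t / N) := by
      refine ⟨?_, ?_, ?_, by simp, ?_, by positivity⟩
      · exact (hhd.comp (by fun_prop) htm).div_const _
      · intro x hx y hy hxy
        have h1 := hinjh (htm hx) (htm hy) ((div_left_inj' hNc).mp hxy)
        exact mul_left_cancel₀ htc h1
      · intro z hz
        rw [mem_ball_zero_iff, norm_div, Complex.norm_real, Real.norm_eq_abs, abs_of_pos hN0,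
          div_lt_one hN0]
        exact (hM0 _ (by rw [mem_closedBall_zero_iff]; exact (htz z hz).le)).trans_lt hM1
      · have m0 : ball (0:ℂ) 1 ∈ 𝓝 ((t:ℂ) * 0) := by rw [mul_zero]; exact ball_mem_nhds 0 one_pos
        have b1 : HasDerivAt (fun z : ℂ => (t:ℂ) * z) t 0 := by
          simpa using (hasDerivAt_id (0:ℂ)).const_mul (t:ℂ)
        have b2 := (hF.diff.differentiableAt m0).hasDerivAt.comp (0:ℂ) b1
        have b3 := (b1.mul (b2.pow 2)).div_const (N:ℂ)
        have b4 := b3.deriv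
        push_cast
        refine Eq.trans ?_ (b4.trans ?_)
        · rfl
        · simp [hF0]
    have hq : PS (fun k => 2 * (γ k * (t:ℂ) ^ k)) 1 (fun z => 2 * Γ (t * z)) := fun z hz => by
      have h1 := hγ ((t:ℂ) * z) (by simpa using htm (by simpa using hz : z ∈ ball (0:ℂ) 1))
      refine hs_congr (h1.mul_left 2) fun k => ?_
      rw [mul_pow]; ring
    have h1 := main_US hUS hq.diff (by simp [hΓ0]) (fun z hz => by
      rw [two_mul, Complex.exp_add, hΓ _ (htm hz)]; push_cast; ring) hq hρ hρ1
    have h2 : D (fun k => 2 * (γ k * (t:ℂ) ^ k)) ρ = 4 * D γ (t ^ 2 * ρ) := by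
      unfold D
      rw [← tsum_mul_left]
      congr 1; funext k
      rw [norm_mul, norm_mul, norm_pow, Complex.norm_real, Real.norm_eq_abs, abs_of_pos ht0, mul_pow,
        Complex.norm_ofNat, mul_pow, mul_pow, ← pow_mul, ← pow_mul, mul_comm k 2]
      ring
    linarith
  intro ρ hρ hρ1
  have hcont : Tendsto (fun t : ℝ => ell (ρ / t ^ 2)) (𝓝[<] 1) (𝓝 (ell ρ)) := by
    have : ContinuousAt (fun t : ℝ => ell (ρ / t ^ 2)) 1 := by
      unfold ell
      refine ContinuousAt.neg (ContinuousAt.log ?_ (by norm_num; linarith))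
      exact continuousAt_const.sub (continuousAt_const.div (by fun_prop) (by norm_num))
    have h2 := this.tendsto
    simp only [one_pow, div_one] at h2
    exact h2.mono_left nhdsWithin_le_nhds
  refine ge_of_tendsto hcont ?_
  have ev : ∀ᶠ t : ℝ in 𝓝[<] 1, t ∈ Ioo (Real.sqrt ρ) 1 :=
    Ioo_mem_nhdsLT (by rw [Real.sqrt_lt' one_pos]; simpa using hρ1)
  filter_upwards [ev] with t ht
  have ht0 : 0 < t := (Real.sqrt_nonneg ρ).trans_lt ht.1
  have hρt : ρ < t ^ 2 := (Real.sqrt_lt' ht0).mp ht.1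
  have := key t ht0 ht.2 (ρ / t ^ 2) (by positivity) ((div_lt_one (by positivity)).mpr hρt)
  rwa [mul_div_cancel₀ _ (by positivity)] at this

theorem star {f : ℂ → ℂ} {a : ℕ → ℂ}
    (hf : ∀ z ∈ ball (0 : ℂ) 1, HasSum (fun k : ℕ => a k * z ^ (2 * k + 1)) (f z)) (ha1 : a 0 = 1)
    (hinj : InjOn f (ball 0 1)) {ρ : ℝ} (hρ : 0 ≤ ρ) (hρ1 : ρ < 1) :
    Summable (fun k => ‖a k‖ ^ 2 * ρ ^ k) ∧ ∑' k, ‖a k‖ ^ 2 * ρ ^ k ≤ 1 / (1 - ρ) := by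
  obtain ⟨F, hF, hfF⟩ := odd_F hf
  obtain ⟨Γ, γ, hγ, hΓ0, hΓ, hD⟩ := milin hF ha1 hfF hinj
  obtain ⟨h1, h2⟩ := lm hγ hF hΓ0 hΓ (fun ρ h h' => D_s1 hγ h h') hρ hρ1
  refine ⟨h1, h2.trans ?_⟩
  have h3 := Real.exp_le_exp.mpr (hD ρ hρ hρ1)
  refine h3.trans_eq ?_
  unfold ell
  rw [Real.exp_neg, Real.exp_log (by linarith), one_div]

end Bohr


namespace Bohr
open Complex Metric Set Filter Topology
open scoped ComplexConjugate

theorem littlewood_poly {v : ℂ → ℂ} {s τ : ℝ} (hs : 0 ≤ s) (hs1 : s < 1)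
    (hv : DifferentiableOn ℂ v (ball 0 1)) (hv0 : v 0 = 0) (hvτ : ∀ z, ‖z‖ = s → ‖v z‖ ≤ τ) (N : ℕ) :
    ∀ α : ℕ → ℂ, M s (fun z => ‖∑ k ∈ Finset.range N, α k * v z ^ k‖ ^ 2) ≤
      ∑ k ∈ Finset.range N, ‖α k‖ ^ 2 * (τ ^ 2) ^ k := by
  have hτ : 0 ≤ τ := (norm_nonneg _).trans (hvτ (s : ℂ) (by simp [abs_of_nonneg hs]))
  induction N with
  | zero => intro α; simp [M_constR]
  | succ N ih =>
    intro α
    set u : ℂ → ℂ := fun z => ∑ k ∈ Finset.range N, α (k + 1) * v z ^ k with hu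
    have hud : DifferentiableOn ℂ u (ball 0 1) := by
      rw [hu]
      exact DifferentiableOn.fun_sum fun k _ => (hv.pow k).const_mul _
    have hsub : sphere (0:ℂ) s ⊆ ball 0 1 := sphere_subset_closedBall.trans (closedBall_subset_ball hs1)
    have huc : ContinuousOn u (sphere 0 s) := hud.continuousOn.mono hsub
    have hvc : ContinuousOn v (sphere 0 s) := hv.continuousOn.mono hsub
    have e1 : (fun z => ‖∑ k ∈ Finset.range (N + 1), α k * v z ^ k‖ ^ 2) =
        fun z => (‖α 0‖ ^ 2 + 2 * (conj (α 0) * (v z * u z)).re) + ‖v z * u z‖ ^ 2 := by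
      funext z
      have : ∑ k ∈ Finset.range (N + 1), α k * v z ^ k = α 0 + v z * u z := by
        rw [Finset.sum_range_succ', hu, Finset.mul_sum, add_comm]
        congr 1
        · simp
        · exact Finset.sum_congr rfl fun k _ => by ring
      rw [this]
      simp only [← Complex.normSq_eq_norm_sq, Complex.normSq_apply]
      simp; ring
    have hwc : ContinuousOn (fun z => conj (α 0) * (v z * u z)) (sphere 0 s) :=
      continuousOn_const.mul (hvc.mul huc)
    have hrc : ContinuousOn (fun z => (conj (α 0) * (v z * u z)).re) (sphere 0 s) :=
      Complex.continuous_re.comp_continuousOn hwc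
    have e2 : M s (fun z => (conj (α 0) * (v z * u z)).re) = 0 := by
      rw [M_re hs hwc, M_analytic (f := fun z => conj (α 0) * (v z * u z)) hs hs1 ((hv.mul hud).const_mul _)]
      simp [hv0]
    have e3 : M s (fun z => ‖v z * u z‖ ^ 2) ≤ τ ^ 2 * M s (fun z => ‖u z‖ ^ 2) := by
      rw [← M_const_mulR]
      refine M_mono hs ((hvc.mul huc).norm.pow 2) (continuousOn_const.mul (huc.norm.pow 2)) fun z hz => ?_
      rw [norm_mul, mul_pow]
      have := hvτ z hz
      gcongr
    rw [e1, M_add (f := fun z => ‖α 0‖ ^ 2 + 2 * (conj (α 0) * (v z * u z)).re)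
        (g := fun z => ‖v z * u z‖ ^ 2) hs
        (continuousOn_const.add (continuousOn_const.mul hrc)) ((hvc.mul huc).norm.pow 2),
      M_add (f := fun _ => ‖α 0‖ ^ 2) (g := fun z => 2 * (conj (α 0) * (v z * u z)).re) hs
        continuousOn_const (continuousOn_const.mul hrc), M_constR, M_const_mulR, e2,
      Finset.sum_range_succ']
    have h4 := ih (fun k => α (k + 1))
    have h5 : ∑ k ∈ Finset.range N, ‖α (k + 1)‖ ^ 2 * (τ ^ 2) ^ (k + 1) =
        τ ^ 2 * ∑ k ∈ Finset.range N, ‖α (k + 1)‖ ^ 2 * (τ ^ 2) ^ k := by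
      rw [Finset.mul_sum]; exact Finset.sum_congr rfl fun k _ => by ring
    have h6 : τ ^ 2 * M s (fun z => ‖u z‖ ^ 2) ≤ τ ^ 2 * ∑ k ∈ Finset.range N, ‖α (k + 1)‖ ^ 2 * (τ ^ 2) ^ k :=
      mul_le_mul_of_nonneg_left h4 (by positivity)
    rw [h5]
    simp only [pow_zero, mul_one]
    linarith

theorem littlewood {v F : ℂ → ℂ} {a : ℕ → ℂ} {s τ : ℝ} (hs : 0 ≤ s) (hs1 : s < 1)
    (hv : DifferentiableOn ℂ v (ball 0 1)) (hv0 : v 0 = 0) (hvτ : ∀ z, ‖z‖ = s → ‖v z‖ ≤ τ)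
    (hvm : MapsTo v (ball 0 1) (ball 0 1))
    (hτ1 : τ < 1) (hF : PS a 1 F) (hsum : Summable (fun k => ‖a k‖ ^ 2 * (τ ^ 2) ^ k)) :
    M s (fun z => ‖F (v z)‖ ^ 2) ≤ ∑' k, ‖a k‖ ^ 2 * (τ ^ 2) ^ k := by
  have hτ : 0 ≤ τ := (norm_nonneg _).trans (hvτ (s : ℂ) (by simp [abs_of_nonneg hs]))
  have hsub : sphere (0:ℂ) s ⊆ ball 0 1 := sphere_subset_closedBall.trans (closedBall_subset_ball hs1)
  have hvc : ContinuousOn v (sphere 0 s) := hv.continuousOn.mono hsub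
  have hFv : ContinuousOn (fun z => F (v z)) (sphere 0 s) :=
    (hF.diff.comp hv hvm).continuousOn.mono hsub
  have hK := (hF.summable hτ hτ1).hasSum
  set K := ∑' k, ‖a k‖ * τ ^ k with hKd
  have step : ∀ N : ℕ, M s (fun z => ‖F (v z)‖ ^ 2) ≤ ∑' k, ‖a k‖ ^ 2 * (τ ^ 2) ^ k +
      2 * K * (K - ∑ k ∈ Finset.range N, ‖a k‖ * τ ^ k) := by
    intro N
    have hPc : ContinuousOn (fun z => ∑ k ∈ Finset.range N, a k * v z ^ k) (sphere 0 s) :=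
      continuousOn_finsetSum _ fun k _ => continuousOn_const.mul (hvc.pow k)
    have h1 : M s (fun z => ‖F (v z)‖ ^ 2) ≤ M s (fun z => ‖∑ k ∈ Finset.range N, a k * v z ^ k‖ ^ 2 +
        2 * K * (K - ∑ k ∈ Finset.range N, ‖a k‖ * τ ^ k)) := by
      refine M_mono hs (hFv.norm.pow 2) ((hPc.norm.pow 2).add continuousOn_const) fun z hz => ?_
      have hvz := hvτ z hz
      have hs1 := hF (v z) (by linarith)
      have hle : ∀ k, ‖a k * v z ^ k‖ ≤ ‖a k‖ * τ ^ k := fun k => by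
        rw [norm_mul, norm_pow]; gcongr
      have b1 : ‖F (v z)‖ ≤ K := norm_hasSum_le hs1 hK.summable hle
      have b2 : ‖∑ k ∈ Finset.range N, a k * v z ^ k‖ ≤ K := by
        refine (norm_sum_le _ _).trans ((Finset.sum_le_sum fun k _ => hle k).trans ?_)
        exact sum_le_hasSum _ (fun k _ => by positivity) hK
      have b3 : ‖F (v z) - ∑ k ∈ Finset.range N, a k * v z ^ k‖ ≤
          K - ∑ k ∈ Finset.range N, ‖a k‖ * τ ^ k :=
        (norm_hasSum_le ((hasSum_nat_add_iff' N).mpr hs1) ((hasSum_nat_add_iff' N).mpr hK).summable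
          (fun k => hle (k + N))).trans_eq ((hasSum_nat_add_iff' N).mpr hK).tsum_eq
      set x := ‖F (v z)‖
      set y := ‖∑ k ∈ Finset.range N, a k * v z ^ k‖
      have b4 : x - y ≤ K - ∑ k ∈ Finset.range N, ‖a k‖ * τ ^ k := (norm_sub_norm_le _ _).trans b3
      have b5 : 0 ≤ K - ∑ k ∈ Finset.range N, ‖a k‖ * τ ^ k := (norm_nonneg _).trans b3
      have x0 : 0 ≤ x := norm_nonneg _
      have y0 : 0 ≤ y := norm_nonneg _
      nlinarith [mul_nonneg (add_nonneg x0 y0) (sub_nonneg.mpr b4), mul_nonneg b5 (by linarith : 0 ≤ 2 * K - (x + y))]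
    rw [M_add (f := fun z => ‖∑ k ∈ Finset.range N, a k * v z ^ k‖ ^ 2)
      (g := fun _ => 2 * K * (K - ∑ k ∈ Finset.range N, ‖a k‖ * τ ^ k)) hs
      (hPc.norm.pow 2) continuousOn_const, M_constR] at h1
    have h2 := littlewood_poly hs hs1 hv hv0 hvτ N a
    have h3 := hsum.sum_le_tsum (Finset.range N) (fun k _ => by positivity)
    linarith
  have hlim : Tendsto (fun N : ℕ => ∑' k, ‖a k‖ ^ 2 * (τ ^ 2) ^ k +
      2 * K * (K - ∑ k ∈ Finset.range N, ‖a k‖ * τ ^ k)) atTop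
      (𝓝 (∑' k, ‖a k‖ ^ 2 * (τ ^ 2) ^ k + 2 * K * (K - K))) :=
    (tendsto_const_nhds.sub hK.tendsto_sum_nat).const_mul _ |>.const_add _
  have := ge_of_tendsto' hlim step
  simpa using this

theorem bsum {f g w : ℂ → ℂ} {a b : ℕ → ℂ}
    (hf : ∀ z ∈ ball (0 : ℂ) 1, HasSum (fun k : ℕ => a k * z ^ (2 * k + 1)) (f z)) (ha1 : a 0 = 1)
    (hinj : InjOn f (ball 0 1))
    (hg : ∀ z ∈ ball (0 : ℂ) 1, HasSum (fun k : ℕ => b k * z ^ (2 * k + 1)) (g z))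
    (hw : DifferentiableOn ℂ w (ball 0 1)) (hw0 : w 0 = 0) (hwm : MapsTo w (ball 0 1) (ball 0 1))
    (hgf : ∀ z ∈ ball (0:ℂ) 1, g z = f (w z)) {r : ℝ} (hr : 0 ≤ r) (hr1 : r < 1) :
    Summable (fun k => ‖b k‖ ^ 2 * r ^ (2 * k + 1)) ∧
      ∑' k, ‖b k‖ ^ 2 * r ^ (2 * k + 1) ≤ r / (1 - r ^ 2) := by
  obtain ⟨F, hF, hfF⟩ := odd_F hf
  set s := Real.sqrt r with hs
  have hs0 : 0 ≤ s := Real.sqrt_nonneg _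
  have hs2 : s ^ 2 = r := Real.sq_sqrt hr
  have hs1 : s < 1 := by nlinarith
  -- full coefficient sequence of `g`
  set β : ℕ → ℂ := fun n => if n % 2 = 1 then b (n / 2) else 0 with hβ
  have hi : Function.Injective (fun k : ℕ => 2 * k + 1) := fun x y h => by simpa using h
  have hβ1 : ∀ k, β (2 * k + 1) = b k := fun k => by
    have h1 : (2 * k + 1) % 2 = 1 := by omega
    have h2 : (2 * k + 1) / 2 = k := by omega
    simp only [hβ, h1, h2, if_true]
  have hβ0 : ∀ n, n ∉ Set.range (fun k : ℕ => 2 * k + 1) → β n = 0 := fun n hn => by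
    by_cases h : n % 2 = 1
    · exact absurd ⟨n / 2, by simp only; omega⟩ hn
    · simp only [hβ, h, if_false]
  have hG : PS β 1 g := fun z hz => by
    refine (hi.hasSum_iff (fun n hn => by rw [hβ0 n hn, zero_mul])).mp ?_
    exact hs_congr (hg z (by simpa using hz)) fun k => by simp [hβ1]
  have hP := hG.parseval_sq hs0 hs1
  have hP2 := (hi.hasSum_iff (f := fun k => ‖β k‖ ^ 2 * s ^ (2 * k))
    (fun n hn => by rw [hβ0 n hn]; simp)).mpr hP
  have hP3 : HasSum (fun k => ‖b k‖ ^ 2 * r ^ (2 * k + 1)) (M s (fun z => ‖g z‖ ^ 2)) := by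
    convert hP2 using 2 with k
    simp only [Function.comp, hβ1]
    rw [pow_mul s, hs2]
  refine ⟨hP3.summable, ?_⟩
  rw [hP3.tsum_eq]
  have hsub : sphere (0:ℂ) s ⊆ ball 0 1 := sphere_subset_closedBall.trans (closedBall_subset_ball hs1)
  have hws : ∀ z, ‖z‖ = s → ‖w z‖ ≤ s := fun z hz => by
    rw [← hz]
    exact Complex.norm_le_norm_of_mapsTo_ball hw (hwm.mono_right ball_subset_closedBall) hw0 (by linarith)
  have hsqm : MapsTo (fun z => w z ^ 2) (ball 0 1) (ball 0 1) := fun z hz => by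
    have := hwm hz
    rw [mem_ball_zero_iff] at this ⊢
    rw [norm_pow]
    nlinarith [norm_nonneg (w z)]
  obtain ⟨st1, st2⟩ := star hf ha1 hinj (ρ := r ^ 2) (by positivity) (by nlinarith)
  have hl := littlewood (v := fun z => w z ^ 2) (τ := r) hs0 hs1 (hw.pow 2) (by simp [hw0]) (fun z hz => by
    rw [norm_pow, ← hs2]
    have := hws z hz
    gcongr) hsqm hr1 hF st1
  have hFc : ContinuousOn (fun z => F (w z ^ 2)) (sphere 0 s) :=
    (hF.diff.comp (hw.pow 2) hsqm).continuousOn.mono hsub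
  have h1 : M s (fun z => ‖g z‖ ^ 2) ≤ M s (fun z => r * ‖F (w z ^ 2)‖ ^ 2) := by
    refine M_mono hs0 ((hG.contOn hs1).norm.pow 2) (continuousOn_const.mul (hFc.norm.pow 2)) fun z hz => ?_
    have hzb : z ∈ ball (0:ℂ) 1 := by rw [mem_ball_zero_iff]; linarith
    rw [hgf z hzb, hfF _ (hwm hzb), norm_mul, mul_pow, ← hs2]
    have := hws z hz
    gcongr
  rw [M_const_mulR] at h1
  calc _ ≤ _ := h1
    _ ≤ r * (1 / (1 - r ^ 2)) := by
      apply mul_le_mul_of_nonneg_left (hl.trans st2) hr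
    _ = _ := by ring

theorem odd_geom {r : ℝ} (hr : 0 ≤ r) (hr1 : r < 1) :
    HasSum (fun k : ℕ => r ^ (2 * k + 1)) (r / (1 - r ^ 2)) := by
  have := (hasSum_geometric_of_lt_one (r := r ^ 2) (by positivity) (by nlinarith)).mul_left r
  rw [← div_eq_mul_inv] at this
  have e : (fun k : ℕ => r ^ (2 * k + 1)) = fun k : ℕ => r * (r ^ 2) ^ k := by
    funext k; rw [pow_succ, pow_mul]; ring
  rw [e]; exact this

theorem bohr_main {f g w : ℂ → ℂ} {a b : ℕ → ℂ}
    (hf : ∀ z ∈ ball (0 : ℂ) 1, HasSum (fun k : ℕ => a k * z ^ (2 * k + 1)) (f z)) (ha1 : a 0 = 1)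
    (hinj : InjOn f (ball 0 1))
    (hg : ∀ z ∈ ball (0 : ℂ) 1, HasSum (fun k : ℕ => b k * z ^ (2 * k + 1)) (g z))
    (hw : DifferentiableOn ℂ w (ball 0 1)) (hw0 : w 0 = 0) (hwm : MapsTo w (ball 0 1) (ball 0 1))
    (hgf : ∀ z ∈ ball (0:ℂ) 1, g z = f (w z)) {r : ℝ} (hr : 0 ≤ r) (hr1 : r < 1) :
    ∑' k : ℕ, ‖b k‖ * r ^ (2 * k + 1) ≤ r / (1 - r ^ 2) := by
  obtain ⟨h1, h2⟩ := bsum hf ha1 hinj hg hw hw0 hwm hgf hr hr1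
  have hT := odd_geom hr hr1
  set T := r / (1 - r ^ 2) with hTd
  have hle : ∀ k, ‖b k‖ * r ^ (2 * k + 1) ≤ (‖b k‖ ^ 2 * r ^ (2 * k + 1) + r ^ (2 * k + 1)) / 2 := fun k => by
    have : 0 ≤ r ^ (2 * k + 1) := by positivity
    nlinarith [mul_nonneg (sq_nonneg (‖b k‖ - 1)) this]
  have hS := (h1.add hT.summable).div_const 2
  have hb := Summable.of_nonneg_of_le (fun k => by positivity) hle hS
  refine (hb.tsum_le_tsum hle hS).trans ?_
  rw [tsum_div_const, h1.tsum_add hT.summable, hT.tsum_eq]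
  linarith

theorem gold : (0:ℝ) < (Real.sqrt 5 - 1) / 2 ∧ (Real.sqrt 5 - 1) / 2 < 1 ∧
    1 - ((Real.sqrt 5 - 1) / 2) ^ 2 = (Real.sqrt 5 - 1) / 2 := by
  have h5 : Real.sqrt 5 ^ 2 = 5 := Real.sq_sqrt (by norm_num)
  have h0 : 0 ≤ Real.sqrt 5 := Real.sqrt_nonneg _
  refine ⟨by nlinarith, by nlinarith, by nlinarith⟩

end Bohr



/-- If `g(z) = ∑_{k≥1} b_{2k-1} z^{2k-1}` is an odd function subordinate to an odd
univalent function `f(z) = ∑_{k≥1} a_{2k-1} z^{2k-1}` with `a_1 = 1`, then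
`∑_{k≥1} |b_{2k-1}| r^{2k-1} ≤ r/(1-r²)` for `0 ≤ r < 1`; in particular the majorant
series is at most `1` for `r ≤ (√5-1)/2`, and this Bohr radius is sharp: equality holds
for `f(z) = g(z) = z/(1-z²)` (whose odd Taylor coefficients are all `1`) at
`r = (√5-1)/2`. -/
theorem bohr_odd_subordinate_odd_univalent (f g : ℂ → ℂ) (a b : ℕ → ℂ)
    (hf : ∀ z ∈ Metric.ball (0 : ℂ) 1, HasSum (fun k : ℕ => a k * z ^ (2 * k + 1)) (f z))
    (ha1 : a 0 = 1)
    (huniv : Set.InjOn f (Metric.ball (0 : ℂ) 1))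
    (hg : ∀ z ∈ Metric.ball (0 : ℂ) 1, HasSum (fun k : ℕ => b k * z ^ (2 * k + 1)) (g z))
    (hsub : ∃ w : ℂ → ℂ, AnalyticOn ℂ w (Metric.ball (0 : ℂ) 1) ∧ w 0 = 0 ∧
      (∀ z ∈ Metric.ball (0 : ℂ) 1, w z ∈ Metric.ball (0 : ℂ) 1) ∧
      (∀ z ∈ Metric.ball (0 : ℂ) 1, g z = f (w z))) :
    (∀ r : ℝ, 0 ≤ r → r < 1 →
      ∑' k : ℕ, ‖b k‖ * r ^ (2 * k + 1) ≤ r / (1 - r ^ 2)) ∧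
    (∀ r : ℝ, 0 ≤ r → r ≤ (Real.sqrt 5 - 1) / 2 →
      ∑' k : ℕ, ‖b k‖ * r ^ (2 * k + 1) ≤ 1) ∧
    -- sharpness: the function `z/(1-z²)`, with all odd coefficients equal to `1`,
    -- has majorant series exactly `1` at `r = (√5-1)/2`
    (∀ z ∈ Metric.ball (0 : ℂ) 1,
      HasSum (fun k : ℕ => (1 : ℂ) * z ^ (2 * k + 1)) (z / (1 - z ^ 2))) ∧
    ∑' k : ℕ, ‖(1 : ℂ)‖ * ((Real.sqrt 5 - 1) / 2) ^ (2 * k + 1) = 1 := by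
  obtain ⟨w, hw, hw0, hwm, hgf⟩ := hsub
  obtain ⟨g0, g1, g2⟩ := Bohr.gold
  have main : ∀ r : ℝ, 0 ≤ r → r < 1 → ∑' k : ℕ, ‖b k‖ * r ^ (2 * k + 1) ≤ r / (1 - r ^ 2) :=
    fun r hr hr1 => Bohr.bohr_main hf ha1 huniv hg hw.differentiableOn hw0 hwm hgf hr hr1
  refine ⟨main, fun r hr hrg => ?_, fun z hz => ?_, ?_⟩
  · have hr1 : r < 1 := lt_of_le_of_lt hrg g1
    refine (main r hr hr1).trans ?_
    rw [div_le_one (by nlinarith)]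
    nlinarith
  · have hz1 : ‖z ^ 2‖ < 1 := by
      have : ‖z‖ < 1 := by simpa using hz
      rw [norm_pow]
      nlinarith [norm_nonneg z]
    have := (hasSum_geometric_of_norm_lt_one hz1).mul_left z
    rw [← div_eq_mul_inv] at this
    refine Bohr.hs_congr this fun k => ?_
    rw [pow_succ, pow_mul]; ring
  · have h1 := Bohr.odd_geom g0.le g1
    rw [g2, div_self g0.ne'] at h1
    simp only [norm_one, one_mul]
    exact h1.tsum_eq
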